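/- arXiv:2005.08301 — 4 statements merged into one kernel-verified Lean document; each statement's English description precedes it below -/
import Mathlib

section
/- There is an absolute constant C > 0 such that for every integer k ≥ 3, every real α ≥ 1, and every weighted multigraph on a vertex set V with |V| = n ≥ k and λ_k > 0, the number of k-cuts of weight at most α·λ_k is at most n^{α·k} · k^{C·α·k²}. -/
open Finset

/-- The weight of a `k`-cut, viewed as a finite partition `P` of the vertex set:
the sum of `w u v` over unordered pairs `{u, v}` lying in different parts
(each ordered pair is counted once in the double sum, hence the factor `1/2`). -/
noncomputable def kCutWeight {V : Type*} [Fintype V] [DecidableEq V] (w : V → V → ℝ)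
    (P : Finpartition (univ : Finset V)) : ℝ :=
  (1 / 2) * ∑ u, ∑ v, if ∃ p ∈ P.parts, u ∈ p ∧ v ∈ p then (0 : ℝ) else w u v

noncomputable section

/-- Half the total weight of the ordered pairs satisfying `R`. -/
def sepWeight {V : Type*} [Fintype V] (w : V → V → ℝ) (R : V → V → Prop) : ℝ :=
  open Classical in (1 / 2) * ∑ u, ∑ v, if R u v then w u v else 0

/-- The weight of the 2-cut `{S, Sᶜ}`. -/
def cutWeight {V : Type*} [Fintype V] (w : V → V → ℝ) (S : Finset V) : ℝ :=
  sepWeight w fun u v => ¬(u ∈ S ↔ v ∈ S)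

/-- Every colouring using at least `k` colours separates total weight at least `L`. -/
def ColouringBound {V : Type*} [Fintype V] (w : V → V → ℝ) (k : ℕ) (L : ℝ) : Prop :=
  ∀ f : V → ℕ, k ≤ (univ.image f).card → L ≤ sepWeight w fun u v => f u ≠ f v

end

section SepWeight

variable {V : Type*} [Fintype V] {w : V → V → ℝ}

lemma sepWeight_nonneg (hw : ∀ u v, 0 ≤ w u v) (R : V → V → Prop) : 0 ≤ sepWeight w R := by
  unfold sepWeight
  refine mul_nonneg (by norm_num) (sum_nonneg fun u _ => sum_nonneg fun v _ => ?_)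
  split_ifs
  exacts [hw u v, le_rfl]

lemma sum_sepWeight {ι : Type*} (s : Finset ι) (R : ι → V → V → Prop) :
    ∑ i ∈ s, sepWeight w (R i) =
      open Classical in (1 / 2) * ∑ u, ∑ v, ∑ i ∈ s, if R i u v then w u v else 0 := by
  classical
  unfold sepWeight
  rw [← mul_sum, sum_comm]
  congr 1
  exact sum_congr rfl fun u _ => sum_comm

lemma sepWeight_mono (hw : ∀ u v, 0 ≤ w u v) {R Q : V → V → Prop} (h : ∀ u v, R u v → Q u v) :
    sepWeight w R ≤ sepWeight w Q := by
  classical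
  unfold sepWeight
  gcongr with u _ v _
  have := hw u v
  have := h u v
  split_ifs <;> first | linarith | tauto

lemma sepWeight_or_le (hw : ∀ u v, 0 ≤ w u v) {P R Q : V → V → Prop}
    (h : ∀ u v, P u v → R u v ∨ Q u v) :
    sepWeight w P ≤ sepWeight w R + sepWeight w Q := by
  classical
  unfold sepWeight
  rw [← mul_add, ← sum_add_distrib]
  simp only [← sum_add_distrib]
  gcongr with u _ v _
  have := hw u v
  have := h u v
  split_ifs <;> first | linarith | tauto

lemma sepWeight_add_le (hw : ∀ u v, 0 ≤ w u v) {P R Q : V → V → Prop}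
    (hP : ∀ u v, P u v → Q u v) (hR : ∀ u v, R u v → Q u v) (h : ∀ u v, P u v → ¬ R u v) :
    sepWeight w P + sepWeight w R ≤ sepWeight w Q := by
  classical
  unfold sepWeight
  rw [← mul_add, ← sum_add_distrib]
  simp only [← sum_add_distrib]
  gcongr with u _ v _
  have := hw u v
  have := h u v
  have := hP u v
  have := hR u v
  split_ifs <;> first | linarith | tauto

lemma sepWeight_le_sum {ι : Type*} (hw : ∀ u v, 0 ≤ w u v) {P : V → V → Prop} (s : Finset ι)
    (R : ι → V → V → Prop) (h : ∀ u v, P u v → ∃ i ∈ s, R i u v) :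
    sepWeight w P ≤ ∑ i ∈ s, sepWeight w (R i) := by
  classical
  rw [sum_sepWeight]
  unfold sepWeight
  gcongr with u _ v _
  have h0 : ∀ i ∈ s, (0 : ℝ) ≤ if R i u v then w u v else 0 := by
    intro i _
    split_ifs
    exacts [hw u v, le_rfl]
  by_cases hP : P u v
  · obtain ⟨i, hi, hR⟩ := h u v hP
    simpa [hP, hR] using single_le_sum h0 hi
  · simpa [hP] using sum_nonneg h0

lemma sum_sepWeight_le {ι : Type*} (hw : ∀ u v, 0 ≤ w u v) {P : V → V → Prop} (s : Finset ι)
    (R : ι → V → V → Prop) (h : ∀ i ∈ s, ∀ u v, R i u v → P u v)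
    (h' : ∀ i ∈ s, ∀ j ∈ s, ∀ u v, R i u v → R j u v → i = j) :
    ∑ i ∈ s, sepWeight w (R i) ≤ sepWeight w P := by
  classical
  rw [sum_sepWeight]
  unfold sepWeight
  gcongr with u _ v _
  by_cases hex : ∃ i ∈ s, R i u v
  · obtain ⟨i, hi, hR⟩ := hex
    rw [sum_eq_single_of_mem i hi fun j hj hji => if_neg fun hRj => hji (h' j hj i hi u v hRj hR)]
    simp [hR, h i hi u v hR]
  · rw [sum_eq_zero fun i hi => if_neg fun hR => hex ⟨i, hi, hR⟩]
    split_ifs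
    exacts [hw u v, le_rfl]

end SepWeight

section Colouring

variable {V : Type*} [Fintype V] {w : V → V → ℝ} {k : ℕ} {L : ℝ}

lemma cutWeight_nonneg (hw : ∀ u v, 0 ≤ w u v) (S : Finset V) : 0 ≤ cutWeight w S :=
  sepWeight_nonneg hw _

lemma cutWeight_compl [DecidableEq V] (w : V → V → ℝ) (S : Finset V) :
    cutWeight w Sᶜ = cutWeight w S := by
  unfold cutWeight
  congr 1
  ext u v
  simp only [mem_compl]
  tauto

lemma ColouringBound.le_sepWeight (h : ColouringBound w k L) {γ : Type*} [Countable γ]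
    [DecidableEq γ] (f : V → γ) (hf : k ≤ (univ.image f).card) :
    L ≤ sepWeight w fun u v => f u ≠ f v := by
  obtain ⟨g, hg⟩ := exists_injective_nat γ
  have h1 := h (g ∘ f) (by rwa [← image_image, card_image_of_injective _ hg])
  simpa [hg.eq_iff] using h1

/-- Disjoint nonempty sets of small cut weight are few. -/
lemma ColouringBound.card_le_of_disjoint (h : ColouringBound w k L) (hw : ∀ u v, 0 ≤ w u v)
    (hk : 2 ≤ k) (Z : Finset (Finset V)) (hne : ∀ A ∈ Z, A.Nonempty)
    (hd : ∀ A ∈ Z, ∀ B ∈ Z, ∀ x, x ∈ A → x ∈ B → A = B)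
    (hc : ∀ A ∈ Z, ((k : ℝ) - 1) * cutWeight w A < L) : Z.card ≤ k - 1 := by
  classical
  by_contra! hcard
  obtain ⟨Y, hYZ, hY⟩ := exists_subset_card_eq hcard.le
  obtain ⟨B, hBZ, hBY⟩ : ∃ B ∈ Z, B ∉ Y := by
    by_contra! hcon
    have := card_le_card (show Z ⊆ Y from hcon)
    omega
  set f : V → Finset (Finset V) := fun x => Y.filter (x ∈ ·) with hf
  have himg : insert ∅ (Y.image fun A => {A}) ⊆ univ.image f := by
    intro T hT
    rw [mem_insert, mem_image] at hT
    rw [mem_image]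
    rcases hT with rfl | ⟨A, hA, rfl⟩
    · obtain ⟨x, hx⟩ := hne B hBZ
      refine ⟨x, mem_univ _, ?_⟩
      simp only [hf, filter_eq_empty_iff]
      intro A hA hxA
      exact hBY (hd B hBZ A (hYZ hA) x hx hxA ▸ hA)
    · obtain ⟨x, hx⟩ := hne A (hYZ hA)
      refine ⟨x, mem_univ _, ?_⟩
      ext A'
      simp only [hf, mem_filter, mem_singleton]
      constructor
      · rintro ⟨hA', hx'⟩
        exact hd A' (hYZ hA') A (hYZ hA) x hx' hx
      · rintro rfl
        exact ⟨hA, hx⟩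
  have hcardimg : k ≤ (univ.image f).card := by
    refine le_trans ?_ (card_le_card himg)
    rw [card_insert_of_notMem (by simp), card_image_of_injective _ singleton_injective, hY]
    omega
  have h1 := h.le_sepWeight f hcardimg
  have h2 : (sepWeight w fun u v => f u ≠ f v) ≤ ∑ A ∈ Y, cutWeight w A := by
    refine sepWeight_le_sum hw Y (fun A u v => ¬(u ∈ A ↔ v ∈ A)) fun u v huv => ?_
    by_contra! hcon
    exact huv (filter_congr hcon)
  have h3 : ((k : ℝ) - 1) * ∑ A ∈ Y, cutWeight w A < ((k : ℝ) - 1) * L := by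
    have hcast : ((k : ℝ) - 1) = Y.card := by
      rw [hY, Nat.cast_sub (by omega), Nat.cast_one]
    have : ∑ A ∈ Y, ((k : ℝ) - 1) * cutWeight w A < ∑ A ∈ Y, L :=
      sum_lt_sum_of_nonempty (card_pos.1 (by omega)) fun A hA => hc A (hYZ hA)
    rw [mul_sum]
    refine this.trans_eq ?_
    rw [sum_const, nsmul_eq_mul, hcast]
  have hk' : (0 : ℝ) < (k : ℝ) - 1 := by
    have : (2 : ℝ) ≤ k := by exact_mod_cast hk
    linarith
  have := lt_of_mul_lt_mul_left h3 hk'.le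
  linarith

/-- Splitting one colour class of a colouring along a set. -/
lemma exists_split_colouring [DecidableEq V] (hw : ∀ u v, 0 ≤ w u v) (f : V → ℕ) (S : Finset V)
    {x y : V}
    (hx : x ∈ S) (hy : y ∉ S) (hxy : f x = f y) :
    ∃ N, (∀ z, f z ≠ N) ∧ ∃ f' : V → ℕ, (∀ z, f' z = if f z = f y ∧ z ∈ S then N else f z) ∧
      (univ.image f').card = (univ.image f).card + 1 ∧
      (sepWeight w fun u v => f' u ≠ f' v) ≤ (sepWeight w fun u v => f u ≠ f v) +
        sepWeight w fun u v => f u = f y ∧ f v = f y ∧ ¬(u ∈ S ↔ v ∈ S) := by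
  classical
  obtain ⟨N, hN⟩ := Infinite.exists_notMem_finset (insert 0 (univ.image f))
  have hN0 : N ≠ 0 := fun h => hN (by simp [h])
  have hN' : ∀ z, f z ≠ N := fun z hz => hN (by simp [← hz])
  refine ⟨N, hN', fun z => if f z = f y ∧ z ∈ S then N else f z, fun z => rfl, ?_, ?_⟩
  · have : univ.image (fun z => if f z = f y ∧ z ∈ S then N else f z) =
        insert N (univ.image f) := by
      ext a
      simp only [mem_image, mem_univ, true_and, mem_insert]
      constructor
      · rintro ⟨z, rfl⟩
        split_ifs
        · exact Or.inl rfl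
        · exact Or.inr ⟨z, rfl⟩
      · rintro (rfl | ⟨z, rfl⟩)
        · exact ⟨x, if_pos ⟨hxy, hx⟩⟩
        · by_cases hz : f z = f y
          · exact ⟨y, by simp [hy, hz]⟩
          · exact ⟨z, by simp [hz]⟩
    rw [this, card_insert_of_notMem fun h => hN (mem_insert_of_mem h)]
  · refine sepWeight_or_le hw fun u v huv => ?_
    by_contra! hcon
    obtain ⟨h1, h2⟩ := hcon
    refine huv ?_
    by_cases hu : f u = f y
    · have := h2 hu (h1 ▸ hu)
      simp [hu, ← h1, this]
    · simp [hu, ← h1]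

/-- The small sets of small cut weight all lie in a common small set. -/
lemma ColouringBound.exists_superset (h : ColouringBound w k L) (hw : ∀ u v, 0 ≤ w u v)
    (hk : 1 ≤ k) (hL : 0 < L) (s : ℕ) :
    ∃ M : Finset V, M.card ≤ k * s ∧
      ∀ Y : Finset V, Y.card ≤ s → k * cutWeight w Y < L → Y ⊆ M := by
  classical
  rcases le_or_gt (Fintype.card V) (k * s) with hV | hV
  · exact ⟨univ, by rwa [card_univ], fun Y _ _ => subset_univ Y⟩
  by_contra! hcon
  have key : ∀ j, j + 1 ≤ k → ∃ f : V → ℕ, (univ.filter (f · ≠ 0)).card ≤ j * s ∧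
      (univ.image f).card = j + 1 ∧ k * (sepWeight w fun u v => f u ≠ f v) ≤ j * L := by
    intro j
    induction j with
    | zero =>
      intro _
      have : Nonempty V := Fintype.card_pos_iff.1 (by omega)
      exact ⟨fun _ => 0, by simp, by rw [image_const univ_nonempty, card_singleton],
        by simp [sepWeight]⟩
    | succ j ih =>
      intro hj
      obtain ⟨f, hf1, hf2, hf3⟩ := ih (by omega)
      have hjs : (j + 1) * s ≤ k * s := Nat.mul_le_mul_right s (by omega)
      rw [add_mul, one_mul] at hjs
      obtain ⟨Y, hYs, hYL, hYf⟩ := hcon (univ.filter (f · ≠ 0)) (by omega)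
      obtain ⟨x, hxY, hx⟩ := not_subset.1 hYf
      simp only [ne_eq, mem_filter, mem_univ, true_and, not_not] at hx
      obtain ⟨y, hy⟩ : ∃ y, y ∉ univ.filter (f · ≠ 0) ∪ Y := by
        by_contra! hall
        have h1 := card_union_le (univ.filter (f · ≠ 0)) Y
        rw [eq_univ_iff_forall.2 hall, card_univ] at h1
        omega
      simp only [ne_eq, mem_union, mem_filter, mem_univ, true_and, not_or, not_not] at hy
      obtain ⟨N, hN, f', hf', hc, hsep⟩ :=
        exists_split_colouring hw f Y hxY hy.2 (hx.trans hy.1.symm)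
      refine ⟨f', ?_, by omega, ?_⟩
      · have : univ.filter (f' · ≠ 0) ⊆ univ.filter (f · ≠ 0) ∪ Y := by
          intro z
          simp only [mem_filter, mem_univ, true_and, mem_union, hf' z]
          split_ifs with hz
          · exact fun _ => Or.inr hz.2
          · exact fun h0 => Or.inl h0
        have h1 := card_le_card this
        have h2 := card_union_le (univ.filter (f · ≠ 0)) Y
        rw [add_mul, one_mul]
        omega
      · have h1 : (sepWeight w fun u v => f u = f y ∧ f v = f y ∧ ¬(u ∈ Y ↔ v ∈ Y)) ≤
            cutWeight w Y := sepWeight_mono hw fun u v h => h.2.2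
        have hk0 : (0 : ℝ) ≤ k := Nat.cast_nonneg k
        have h2 := mul_le_mul_of_nonneg_left (hsep.trans (add_le_add_right h1 _)) hk0
        push_cast
        linarith
  obtain ⟨f, -, hf2, hf3⟩ := key (k - 1) (by omega)
  have h1 := h f (by omega)
  have h2 : (k : ℝ) * L ≤ (k - 1 : ℕ) * L :=
    (mul_le_mul_of_nonneg_left h1 (Nat.cast_nonneg k)).trans hf3
  rw [Nat.cast_sub hk] at h2
  push_cast at h2
  linarith

end Colouring

/-- If every proper extension of a set to a member of a family has to use one of at most `m` new
elements, then there are few members of the family with `s` more elements. -/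
lemma card_filter_le_of_branching {V : Type*} [DecidableEq V] (G : Finset (Finset V))
    (Y₀ : Finset V) (m : ℕ)
    (h : ∀ Y, Y₀ ⊆ Y → ∃ X : Finset V, X.card ≤ m ∧
      ∀ S ∈ G, Y ⊂ S → ∃ x ∈ X, x ∈ S ∧ x ∉ Y) (s : ℕ) :
    ∀ Y, Y₀ ⊆ Y → (G.filter fun S => Y ⊆ S ∧ S.card ≤ Y.card + s).card ≤ (m + 1) ^ s := by
  induction s with
  | zero =>
    intro Y _
    refine (card_le_card (t := {Y}) fun S hS => ?_).trans (by simp)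
    rw [mem_filter] at hS
    rw [mem_singleton]
    exact (eq_of_subset_of_card_le hS.2.1 hS.2.2).symm
  | succ s ih =>
    intro Y hY
    obtain ⟨X, hXm, hX⟩ := h Y hY
    set X' := X.filter (· ∉ Y) with hX'
    have hsub : (G.filter fun S => Y ⊆ S ∧ S.card ≤ Y.card + (s + 1)) ⊆
        insert Y (X'.biUnion fun x =>
          G.filter fun S => insert x Y ⊆ S ∧ S.card ≤ (insert x Y).card + s) := by
      intro S hS
      rw [mem_filter] at hS
      rw [mem_insert, mem_biUnion]
      by_cases hYS : S = Y
      · exact Or.inl hYS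
      right
      obtain ⟨x, hxX, hxS, hxY⟩ := hX S hS.1 (hS.2.1.ssubset_of_ne (Ne.symm hYS))
      refine ⟨x, mem_filter.2 ⟨hxX, hxY⟩, mem_filter.2 ⟨hS.1, insert_subset hxS hS.2.1, ?_⟩⟩
      rw [card_insert_of_notMem hxY]
      omega
    have hX'm : X'.card ≤ m := (card_filter_le _ _).trans hXm
    calc _ ≤ _ := card_le_card hsub
      _ ≤ (X'.biUnion _).card + 1 := card_insert_le _ _
      _ ≤ X'.card * (m + 1) ^ s + 1 := by
        gcongr
        exact card_biUnion_le_card_mul _ _ _ fun x _ =>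
          ih _ (hY.trans (subset_insert x Y))
      _ ≤ m * (m + 1) ^ s + (m + 1) ^ s := by
        gcongr
        exact Nat.one_le_pow _ _ (by omega)
      _ = _ := by ring

/-- The sets whose cut weight is less than `2 * L / k`. -/
noncomputable def lightSets {V : Type*} [Fintype V] (w : V → V → ℝ) (k : ℕ) (L : ℝ) :
    Finset (Finset V) :=
  open Classical in univ.filter fun S => k * cutWeight w S < 2 * L

section LightSets

variable {V : Type*} [Fintype V] {w : V → V → ℝ} {k : ℕ} {L : ℝ}

lemma mem_lightSets {S : Finset V} : S ∈ lightSets w k L ↔ k * cutWeight w S < 2 * L := by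
  classical
  simp [lightSets]

lemma ColouringBound.le_sum_cutWeight (h : ColouringBound w k L) (hw : ∀ u v, 0 ≤ w u v)
    (hk : 2 ≤ k) (hL : 0 ≤ L) (Z : Finset (Finset V)) (hne : ∀ A ∈ Z, A.Nonempty)
    (hd : ∀ A ∈ Z, ∀ B ∈ Z, ∀ x, x ∈ A → x ∈ B → A = B) :
    ((Z.card : ℝ) - ((k : ℝ) - 1)) * L ≤ ((k : ℝ) - 1) * ∑ A ∈ Z, cutWeight w A := by
  classical
  have hk' : (0 : ℝ) ≤ (k : ℝ) - 1 := by
    have : (2 : ℝ) ≤ k := by exact_mod_cast hk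
    linarith
  set p : Finset V → Prop := fun A => ((k : ℝ) - 1) * cutWeight w A < L with hp
  have h1 : (Z.filter p).card ≤ k - 1 := by
    refine h.card_le_of_disjoint hw hk _ (fun A hA => hne A (mem_filter.1 hA).1) ?_
      fun A hA => (mem_filter.1 hA).2
    exact fun A hA B hB => hd A (mem_filter.1 hA).1 B (mem_filter.1 hB).1
  have h1' : ((Z.filter p).card : ℝ) ≤ (k : ℝ) - 1 := by
    have : ((Z.filter p).card : ℝ) ≤ (k - 1 : ℕ) := by exact_mod_cast h1
    rwa [Nat.cast_sub (by omega), Nat.cast_one] at this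
  have h2 : ((Z.filter p).card : ℝ) + (Z.filter (¬ p ·)).card = Z.card := by
    exact_mod_cast card_filter_add_card_filter_not p
  have h3 : ((Z.filter (¬ p ·)).card : ℝ) * L ≤
      ∑ A ∈ Z.filter (¬ p ·), ((k : ℝ) - 1) * cutWeight w A := by
    rw [← nsmul_eq_mul]
    refine card_nsmul_le_sum _ _ _ fun A hA => ?_
    exact not_lt.1 (mem_filter.1 hA).2
  have h4 : ∑ A ∈ Z.filter (¬ p ·), ((k : ℝ) - 1) * cutWeight w A ≤
      ∑ A ∈ Z, ((k : ℝ) - 1) * cutWeight w A :=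
    sum_le_sum_of_subset_of_nonneg (filter_subset _ _)
      fun A _ _ => mul_nonneg hk' (cutWeight_nonneg hw A)
  rw [mul_sum]
  refine le_trans ?_ (h3.trans h4)
  gcongr
  linarith

lemma cutWeight_add_le_union [DecidableEq V] (hw : ∀ u v, 0 ≤ w u v) {Y Z : Finset V}
    (hYZ : Disjoint Z Y) :
    cutWeight w Z + cutWeight w Y ≤ cutWeight w (Y ∪ Z) +
      2 * sepWeight w fun u v => (u ∈ Y ∧ v ∈ Z) ∨ (u ∈ Z ∧ v ∈ Y) := by
  classical
  have hd : ∀ x, x ∈ Z → x ∉ Y := fun x hx => disjoint_left.1 hYZ hx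
  unfold cutWeight sepWeight
  have : ∀ a b c d : ℝ, a + b ≤ c + 2 * d →
      1 / 2 * a + 1 / 2 * b ≤ 1 / 2 * c + 2 * (1 / 2 * d) := by intros; linarith
  apply this
  simp only [mul_sum, ← sum_add_distrib]
  refine sum_le_sum fun u _ => sum_le_sum fun v _ => ?_
  have := hw u v
  have h1 := hd u
  have h2 := hd v
  simp only [mem_union]
  split_ifs <;> first | linarith | (exfalso; tauto)

/-- Few pairwise disjoint sets can be glued to a set that is not too light. -/
lemma ColouringBound.card_lt_of_sunflower [DecidableEq V] (h : ColouringBound w k L)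
    (hw : ∀ u v, 0 ≤ w u v) (hk : 2 ≤ k) (hL : 0 < L) (Y : Finset V)
    (hY : L ≤ k * cutWeight w Y) (Z : Finset (Finset V)) (hne : ∀ A ∈ Z, A.Nonempty)
    (hd : ∀ A ∈ Z, ∀ B ∈ Z, ∀ x, x ∈ A → x ∈ B → A = B) (hZY : ∀ A ∈ Z, Disjoint A Y)
    (hZ : ∀ A ∈ Z, Y ∪ A ∈ lightSets w k L) : Z.card ≤ 2 * k ^ 2 := by
  by_contra! hcard
  have hZY' : ∀ A ∈ Z, ∀ x, x ∈ A → x ∉ Y := fun A hA x hx => disjoint_left.1 (hZY A hA) hx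
  have hk2 : (2 : ℝ) ≤ k := by exact_mod_cast hk
  have h1 := h.le_sum_cutWeight hw hk hL.le Z hne hd
  have h2 : ∑ A ∈ Z, (cutWeight w A + cutWeight w Y) ≤ ∑ A ∈ Z, (cutWeight w (Y ∪ A) +
      2 * sepWeight w fun u v => (u ∈ Y ∧ v ∈ A) ∨ (u ∈ A ∧ v ∈ Y)) :=
    sum_le_sum fun A hA => cutWeight_add_le_union hw (hZY A hA)
  have h3 : ∑ A ∈ Z, (sepWeight w fun u v => (u ∈ Y ∧ v ∈ A) ∨ (u ∈ A ∧ v ∈ Y)) ≤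
      cutWeight w Y := by
    refine sum_sepWeight_le hw Z _ (fun A hA u v huv => ?_) fun A hA B hB u v hA' hB' => ?_
    · have := hZY' A hA u
      have := hZY' A hA v
      tauto
    · have := hZY' A hA u
      have := hZY' A hA v
      have := hZY' B hB u
      have := hZY' B hB v
      rcases hA' with ⟨ha, hb⟩ | ⟨ha, hb⟩
      · exact hd A hA B hB v hb (by tauto)
      · exact hd A hA B hB u ha (by tauto)
  have h4 : ∑ A ∈ Z, (k : ℝ) * cutWeight w (Y ∪ A) ≤ ∑ A ∈ Z, 2 * L :=
    sum_le_sum fun A hA => (mem_lightSets.1 (hZ A hA)).le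
  rw [sum_add_distrib, sum_add_distrib, ← mul_sum, sum_const, nsmul_eq_mul] at h2
  rw [← mul_sum, sum_const, nsmul_eq_mul] at h4
  have hr : 2 * (k : ℝ) ^ 2 + 1 ≤ Z.card := by exact_mod_cast hcard
  set r : ℝ := (Z.card : ℝ)
  set SZ := ∑ A ∈ Z, cutWeight w A
  set SU := ∑ A ∈ Z, cutWeight w (Y ∪ A)
  set D := cutWeight w Y
  have h5 : SZ + (r - 2) * D ≤ SU := by linarith
  have h6 : (r - 2) * L ≤ (r - 2) * (k * D) := by
    refine mul_le_mul_of_nonneg_left hY ?_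
    nlinarith
  have h7 : (k : ℝ) * SZ + (r - 2) * L ≤ r * (2 * L) := by
    nlinarith
  have h8 : ((k : ℝ) - 1) * (k * SZ + (r - 2) * L) ≤ (k - 1) * (r * (2 * L)) :=
    mul_le_mul_of_nonneg_left h7 (by linarith)
  have h9 : (k : ℝ) * ((r - (k - 1)) * L) ≤ k * ((k - 1) * SZ) :=
    mul_le_mul_of_nonneg_left h1 (by linarith)
  have h10 : (r - (k - 1) * (k + 2)) * L ≤ 0 := by nlinarith
  have : 0 < r - (k - 1) * (k + 2) := by nlinarith
  nlinarith

lemma ColouringBound.exists_branching_set [DecidableEq V] (h : ColouringBound w k L)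
    (hw : ∀ u v, 0 ≤ w u v) (hk : 2 ≤ k) (hL : 0 < L) (s : ℕ) (G : Finset (Finset V))
    (hG : ∀ S ∈ G, S ∈ lightSets w k L ∧ S.card ≤ s) (Y : Finset V)
    (hY : Y.card ≤ s → L ≤ k * cutWeight w Y) :
    ∃ X : Finset V, X.card ≤ 2 * k ^ 2 * s ∧ ∀ S ∈ G, Y ⊂ S → ∃ x ∈ X, x ∈ S ∧ x ∉ Y := by
  classical
  rcases le_or_gt Y.card s with hYs | hYs
  swap
  · refine ⟨∅, by simp, fun S hS hYS => ?_⟩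
    have := card_lt_card hYS
    have := (hG S hS).2
    omega
  set good : Finset (Finset V) → Prop := fun Z => (∀ A ∈ Z, A.Nonempty ∧ Disjoint A Y ∧
    Y ∪ A ∈ G) ∧ ∀ A ∈ Z, ∀ B ∈ Z, ∀ x, x ∈ A → x ∈ B → A = B with hgood
  obtain ⟨Z, hZ, hmax⟩ := exists_max_image (univ.filter good) card
    ⟨∅, mem_filter.2 ⟨mem_univ _, by simp [hgood]⟩⟩
  obtain ⟨hZ1, hZ2⟩ := (mem_filter.1 hZ).2
  have hcard : Z.card ≤ 2 * k ^ 2 := h.card_lt_of_sunflower hw hk hL Y (hY hYs) Z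
    (fun A hA => (hZ1 A hA).1) hZ2 (fun A hA => (hZ1 A hA).2.1)
    fun A hA => (hG _ (hZ1 A hA).2.2).1
  refine ⟨Z.biUnion id, ?_, fun S hS hYS => ?_⟩
  · refine (card_biUnion_le_card_mul Z id s fun A hA => ?_).trans (Nat.mul_le_mul_right s hcard)
    exact (card_le_card subset_union_right).trans (hG _ (hZ1 A hA).2.2).2
  · by_contra! hcon
    have hdis : ∀ A ∈ Z, ∀ x, x ∈ A → x ∉ S \ Y := by
      intro A hA x hxA hx
      rw [mem_sdiff] at hx
      exact hx.2 (hcon x (mem_biUnion.2 ⟨A, hA, hxA⟩) hx.1)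
    obtain ⟨y, hyS, hyY⟩ := exists_of_ssubset hYS
    have hy : y ∈ S \ Y := mem_sdiff.2 ⟨hyS, hyY⟩
    have hnot : S \ Y ∉ Z := fun hmem => hdis _ hmem y hy hy
    have := hmax (insert (S \ Y) Z) (mem_filter.2 ⟨mem_univ _, ?_, ?_⟩)
    · rw [card_insert_of_notMem hnot] at this
      omega
    · intro A hA
      rcases mem_insert.1 hA with rfl | hA
      · exact ⟨⟨y, hy⟩, sdiff_disjoint, by rwa [union_sdiff_of_subset hYS.subset]⟩
      · exact hZ1 A hA
    · intro A hA B hB x hxA hxB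
      rcases mem_insert.1 hA with rfl | hA <;> rcases mem_insert.1 hB with rfl | hB
      · rfl
      · exact absurd hxA (hdis B hB x hxB)
      · exact absurd hxB (hdis A hA x hxA)
      · exact hZ2 A hA B hB x hxA hxB

/-- The number of light sets when all of them are small or have small complement. -/
lemma ColouringBound.card_lightSets_le_of_small [DecidableEq V] (h : ColouringBound w k L)
    (hw : ∀ u v, 0 ≤ w u v) (hk : 2 ≤ k) (hL : 0 < L) (s : ℕ)
    (hs : ∀ S ∈ lightSets w k L, S.card ≤ s ∨ Sᶜ.card ≤ s) :
    (lightSets w k L).card ≤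
      2 * ((k * s + 1) ^ s + Fintype.card V * (2 * k ^ 2 * s + 1) ^ s) := by
  obtain ⟨M, hMc, hM⟩ := h.exists_superset hw (by omega) hL s
  set G := (lightSets w k L).filter (·.card ≤ s) with hG
  have hGmem : ∀ S ∈ G, S ∈ lightSets w k L ∧ S.card ≤ s := fun S hS => mem_filter.1 hS
  have h1 : lightSets w k L ⊆ G ∪ G.image compl := by
    intro S hS
    rw [mem_union, mem_image]
    rcases hs S hS with hc | hc
    · exact Or.inl (mem_filter.2 ⟨hS, hc⟩)
    · refine Or.inr ⟨Sᶜ, mem_filter.2 ⟨?_, hc⟩, compl_compl S⟩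
      rw [mem_lightSets, cutWeight_compl]
      exact mem_lightSets.1 hS
  have h2 : G ⊆ (G.filter (· ⊆ M)) ∪ (univ.filter (· ∉ M)).biUnion fun x =>
      G.filter fun S => {x} ⊆ S ∧ S.card ≤ ({x} : Finset V).card + s := by
    intro S hS
    rw [mem_union, mem_biUnion]
    by_cases hSM : S ⊆ M
    · exact Or.inl (mem_filter.2 ⟨hS, hSM⟩)
    · obtain ⟨x, hx, hxM⟩ := not_subset.1 hSM
      refine Or.inr ⟨x, mem_filter.2 ⟨mem_univ x, hxM⟩, mem_filter.2 ⟨hS, ?_, ?_⟩⟩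
      · simpa using hx
      · have := (hGmem S hS).2
        omega
  have h3 : (G.filter (· ⊆ M)).card ≤ (k * s + 1) ^ s := by
    have := card_filter_le_of_branching (G.filter (· ⊆ M)) ∅ (k * s) (fun Y _ => ⟨M, hMc,
      fun S hS hYS => ?_⟩) s ∅ (subset_refl _)
    · refine le_trans (card_le_card fun S hS => ?_) this
      refine mem_filter.2 ⟨hS, empty_subset S, ?_⟩
      simpa using (hGmem S (mem_filter.1 hS).1).2
    · obtain ⟨x, hxS, hxY⟩ := exists_of_ssubset hYS
      exact ⟨x, (mem_filter.1 hS).2 hxS, hxS, hxY⟩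
  have h4 : ∀ x ∈ univ.filter (· ∉ M), (G.filter fun S => {x} ⊆ S ∧
      S.card ≤ ({x} : Finset V).card + s).card ≤ (2 * k ^ 2 * s + 1) ^ s := by
    intro x hx
    refine card_filter_le_of_branching G {x} (2 * k ^ 2 * s) (fun Y hY => ?_) s {x}
      (subset_refl _)
    refine h.exists_branching_set hw hk hL s G hGmem Y fun hYs => ?_
    by_contra! hlt
    exact (mem_filter.1 hx).2 (hM Y hYs hlt (hY (mem_singleton_self x)))
  have h5 : G.card ≤ (k * s + 1) ^ s + Fintype.card V * (2 * k ^ 2 * s + 1) ^ s := by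
    refine (card_le_card h2).trans ((card_union_le _ _).trans (add_le_add h3 ?_))
    refine (card_biUnion_le_card_mul _ _ _ h4).trans (Nat.mul_le_mul_right _ ?_)
    exact card_le_univ _
  calc _ ≤ _ := card_le_card h1
    _ ≤ G.card + (G.image compl).card := card_union_le _ _
    _ ≤ G.card + G.card := Nat.add_le_add_left card_image_le _
    _ ≤ _ := by omega

end LightSets

section Contraction

variable {V U : Type*} [Fintype V] [Fintype U] [DecidableEq U] {w : V → V → ℝ} {k : ℕ} {L : ℝ}

/-- The weights obtained by contracting the fibres of `g`. -/
def contractWeight (g : V → U) (w : V → V → ℝ) (p q : U) : ℝ :=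
  ∑ u, ∑ v, if g u = p ∧ g v = q then w u v else 0

omit [Fintype U] in
lemma contractWeight_nonneg (hw : ∀ u v, 0 ≤ w u v) (g : V → U) (p q : U) :
    0 ≤ contractWeight g w p q := by
  refine sum_nonneg fun u _ => sum_nonneg fun v _ => ?_
  split_ifs
  exacts [hw u v, le_rfl]

lemma sepWeight_contractWeight (g : V → U) (R : U → U → Prop) :
    sepWeight (contractWeight g w) R = sepWeight w fun u v => R (g u) (g v) := by
  classical
  unfold sepWeight contractWeight
  congr 1
  have h1 : ∀ p q, (if R p q then ∑ u, ∑ v, if g u = p ∧ g v = q then w u v else 0 else 0) =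
      ∑ u, ∑ v, if g u = p then (if g v = q then (if R p q then w u v else 0) else 0) else 0 := by
    intro p q
    by_cases hR : R p q
    · simp only [if_pos hR, ite_and]
    · simp [hR]
  simp only [h1]
  calc _ = ∑ p, ∑ u, ∑ q, ∑ v,
        (if g u = p then (if g v = q then (if R p q then w u v else 0) else 0) else 0) :=
        sum_congr rfl fun p _ => sum_comm
    _ = ∑ u, ∑ p, ∑ v, ∑ q,
        (if g u = p then (if g v = q then (if R p q then w u v else 0) else 0) else 0) := by
        rw [sum_comm]
        exact sum_congr rfl fun u _ => sum_congr rfl fun p _ => sum_comm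
    _ = ∑ u, ∑ v, ∑ p, ∑ q,
        (if g u = p then (if g v = q then (if R p q then w u v else 0) else 0) else 0) :=
        sum_congr rfl fun u _ => sum_comm
    _ = _ := by
        refine sum_congr rfl fun u _ => sum_congr rfl fun v _ => ?_
        rw [sum_eq_single (g u) (fun p _ hp => by simp [hp.symm]) (by simp),
          sum_eq_single (g v) (fun p _ hp => by simp [hp.symm]) (by simp)]
        simp

lemma ColouringBound.contract (h : ColouringBound w k L) {g : V → U}
    (hg : Function.Surjective g) : ColouringBound (contractWeight g w) k L := by
  intro f hf
  rw [sepWeight_contractWeight]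
  refine h (f ∘ g) ?_
  rwa [← image_image, image_univ_of_surjective hg]

/-- The light sets that are unions of fibres of `g`. -/
noncomputable def invariantLightSets {γ : Type*} (w : V → V → ℝ) (k : ℕ) (L : ℝ) (g : V → γ) :
    Finset (Finset V) :=
  open Classical in (lightSets w k L).filter fun S => ∀ u v, g u = g v → (u ∈ S ↔ v ∈ S)

lemma mem_invariantLightSets {γ : Type*} {g : V → γ} {S : Finset V} :
    S ∈ invariantLightSets w k L g ↔
      S ∈ lightSets w k L ∧ ∀ u v, g u = g v → (u ∈ S ↔ v ∈ S) := by
  simp [invariantLightSets]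

lemma card_invariantLightSets_le (g : V → U) :
    (invariantLightSets w k L g).card ≤ (lightSets (contractWeight g w) k L).card := by
  classical
  refine (card_le_card (t := (lightSets (contractWeight g w) k L).image
    fun T => univ.filter (g · ∈ T)) fun S hS => ?_).trans card_image_le
  obtain ⟨hS1, hS2⟩ := mem_invariantLightSets.1 hS
  have hmem : ∀ v, g v ∈ S.image g ↔ v ∈ S := by
    intro v
    rw [mem_image]
    constructor
    · rintro ⟨u, hu, huv⟩
      exact (hS2 u v huv).1 hu
    · exact fun hv => ⟨v, hv, rfl⟩
  refine mem_image.2 ⟨S.image g, ?_, by ext; simp only [mem_filter, mem_univ, true_and, hmem]⟩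
  rw [mem_lightSets] at hS1 ⊢
  unfold cutWeight at hS1 ⊢
  rw [sepWeight_contractWeight]
  simpa only [hmem] using hS1

end Contraction

section Induction

variable {V : Type*} [Fintype V] [DecidableEq V] {w : V → V → ℝ} {k : ℕ} {L : ℝ}

/-- A nontrivial light set refines to a colouring such that every light set splits at most one
colour class. -/
lemma ColouringBound.exists_colouring (h : ColouringBound w k L) (hw : ∀ u v, 0 ≤ w u v)
    (hk : 2 ≤ k) {S₁ : Finset V} (hS₁ : S₁ ∈ lightSets w k L) {x y : V} (hx : x ∈ S₁)
    (hy : y ∉ S₁) :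
    ∃ f : V → ℕ, (univ.image f).card < k ∧ (∀ u v, f u = f v → (u ∈ S₁ ↔ v ∈ S₁)) ∧
      ∀ S ∈ lightSets w k L, ∃ a ∈ univ.image f,
        ∀ u v, f u = f v → f u ≠ a → (u ∈ S ↔ v ∈ S) := by
  have hk0 : (0 : ℝ) ≤ k := Nat.cast_nonneg k
  have key : ∀ m, ∀ f : V → ℕ, (univ.image f).card + m = k →
      (∀ u v, f u = f v → (u ∈ S₁ ↔ v ∈ S₁)) →
      k * (sepWeight w fun u v => f u ≠ f v) < (univ.image f).card * L →
      ∃ f : V → ℕ, (univ.image f).card < k ∧ (∀ u v, f u = f v → (u ∈ S₁ ↔ v ∈ S₁)) ∧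
      ∀ S ∈ lightSets w k L, ∃ a ∈ univ.image f,
        ∀ u v, f u = f v → f u ≠ a → (u ∈ S ↔ v ∈ S) := by
    intro m
    induction m with
    | zero =>
      intro f hq _ hf
      rw [add_zero] at hq
      rw [hq] at hf
      exact absurd (lt_of_mul_lt_mul_left hf hk0) (not_lt.2 (h f hq.ge))
    | succ m ih =>
      intro f hq href hf
      by_contra! hcon
      obtain ⟨S, hS, hSf⟩ := hcon f (by omega) href
      have hsplit : ∀ u v, f u = f v → ¬(u ∈ S ↔ v ∈ S) →
          L ≤ k * sepWeight w fun p q => f p = f v ∧ f q = f v ∧ ¬(p ∈ S ↔ q ∈ S) := by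
        have hsplit' : ∀ u v, f u = f v → u ∈ S → v ∉ S →
            L ≤ k * sepWeight w fun p q => f p = f v ∧ f q = f v ∧ ¬(p ∈ S ↔ q ∈ S) := by
          intro u v huv hu hv
          by_contra hlt
          rw [not_le] at hlt
          obtain ⟨N, hN, f', hf', hc, hsep⟩ := exists_split_colouring hw f S hu hv huv
          have hfin := ih f' (by omega) (fun p q hpq => href p q ?_) ?_
          · obtain ⟨f₀, h1, h2, h3⟩ := hfin
            obtain ⟨S', hS', hS'f⟩ := hcon f₀ h1 h2
            obtain ⟨a, ha, haf⟩ := h3 S' hS'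
            obtain ⟨p, q, hpq, hpa, hne⟩ := hS'f a ha
            have := haf p q hpq hpa
            tauto
          · rw [hf', hf'] at hpq
            split_ifs at hpq with h1 h2 h2
            · exact h1.1.trans h2.1.symm
            · exact absurd hpq.symm (hN q)
            · exact absurd hpq (hN p)
            · exact hpq
          · have := mul_le_mul_of_nonneg_left hsep hk0
            rw [hc]
            push_cast
            linarith
        intro u v huv hne
        by_cases hu : u ∈ S
        · exact hsplit' u v huv hu (by tauto)
        · have := hsplit' v u huv.symm (by tauto) hu
          rwa [huv] at this
      obtain ⟨u, v, huv, -, hne⟩ := hSf (f x) (mem_image_of_mem f (mem_univ x))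
      obtain ⟨u', v', huv', hb, hne'⟩ := hSf (f v) (mem_image_of_mem f (mem_univ v))
      have h1 := hsplit u v huv (by tauto)
      have h2 := hsplit u' v' huv' (by tauto)
      have h3 : (sepWeight w fun p q => f p = f v ∧ f q = f v ∧ ¬(p ∈ S ↔ q ∈ S)) +
          (sepWeight w fun p q => f p = f v' ∧ f q = f v' ∧ ¬(p ∈ S ↔ q ∈ S)) ≤
          cutWeight w S :=
        sepWeight_add_le hw (fun p q h => h.2.2) (fun p q h => h.2.2)
          fun p q h h' => hb (huv'.trans (h'.1.symm.trans h.1))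
      have h4 := mul_le_mul_of_nonneg_left h3 hk0
      have h5 := mem_lightSets.1 hS
      linarith
  set f₁ : V → ℕ := fun z => if z ∈ S₁ then 0 else 1 with hf₁
  have himg : univ.image f₁ = {0, 1} := by
    ext a
    simp only [mem_image, mem_univ, true_and, mem_insert, mem_singleton, hf₁]
    constructor
    · rintro ⟨z, rfl⟩
      split_ifs <;> simp
    · rintro (rfl | rfl)
      exacts [⟨x, if_pos hx⟩, ⟨y, if_neg hy⟩]
  have hiff : ∀ u v, f₁ u = f₁ v ↔ (u ∈ S₁ ↔ v ∈ S₁) := by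
    intro u v
    by_cases hu : u ∈ S₁ <;> by_cases hv : v ∈ S₁ <;> simp [hf₁, hu, hv]
  refine key (k - 2) f₁ ?_ (fun u v => (hiff u v).1) ?_
  · rw [himg, card_pair (by norm_num)]
    omega
  · rw [himg, card_pair (by norm_num)]
    simp only [ne_eq, hiff]
    exact_mod_cast mem_lightSets.1 hS₁

/-- The map contracting all colour classes of `f` other than `a`. -/
def contractOthers (f : V → ℕ) (a : ℕ) (v : V) : V ⊕ ℕ :=
  if f v = a then Sum.inl v else Sum.inr (f v)

lemma eq_of_contractOthers_eq {V : Type*} {f : V → ℕ} {a : ℕ} {u v : V}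
    (h : contractOthers f a u = contractOthers f a v) : u = v ∨ (f u = f v ∧ f u ≠ a) := by
  unfold contractOthers at h
  split_ifs at h with h1 h2 h2
  · exact Or.inl (Sum.inl.inj h)
  · exact Or.inr ⟨Sum.inr.inj h, h1⟩

lemma card_image_contractOthers_le (f : V → ℕ) {a : ℕ} (ha : a ∈ univ.image f) :
    (univ.image (contractOthers f a)).card ≤
      (univ.filter (f · = a)).card + ((univ.image f).card - 1) := by
  have hsub : (univ.image (contractOthers f a)) ⊆
      (univ.filter (f · = a)).image Sum.inl ∪ ((univ.image f).erase a).image Sum.inr := by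
    intro p hp
    obtain ⟨v, -, rfl⟩ := mem_image.1 hp
    rw [mem_union]
    unfold contractOthers
    split_ifs with hv
    · exact Or.inl (mem_image_of_mem _ (by simpa using hv))
    · exact Or.inr (mem_image_of_mem _ (mem_erase.2 ⟨hv, mem_image_of_mem f (mem_univ v)⟩))
  calc _ ≤ _ := card_le_card hsub
    _ ≤ _ := card_union_le _ _
    _ ≤ _ := add_le_add card_image_le card_image_le
    _ = _ := by rw [card_erase_of_mem ha]

lemma ColouringBound.exists_contraction.{u} {V : Type u} [Fintype V] [DecidableEq V]
    {w : V → V → ℝ} (h : ColouringBound w k L) (hw : ∀ u v, 0 ≤ w u v) (f : V → ℕ) {a : ℕ}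
    (ha : a ∈ univ.image f) :
    ∃ (U : Type u) (_ : Fintype U) (_ : DecidableEq U) (w' : U → U → ℝ),
      Fintype.card U ≤ (univ.filter (f · = a)).card + ((univ.image f).card - 1) ∧
      (∀ u v, 0 ≤ w' u v) ∧ ColouringBound w' k L ∧
      (invariantLightSets w k L (contractOthers f a)).card ≤ (lightSets w' k L).card := by
  obtain ⟨T, hT⟩ : ∃ T, T = univ.image (contractOthers f a) := ⟨_, rfl⟩
  let g : V → {p // p ∈ T} := fun v => ⟨contractOthers f a v, hT ▸ mem_image_of_mem _ (mem_univ v)⟩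
  have hg : Function.Surjective g := by
    rintro ⟨p, hp⟩
    obtain ⟨v, -, hv⟩ := mem_image.1 (hT ▸ hp)
    exact ⟨v, Subtype.ext hv⟩
  refine ⟨{p // p ∈ T}, inferInstance, inferInstance, contractWeight g w, ?_,
    contractWeight_nonneg hw g, h.contract hg, ?_⟩
  · refine (Fintype.card_coe T).trans_le ?_
    rw [hT]
    exact card_image_contractOthers_le f ha
  · refine (card_le_card fun S hS => ?_).trans (card_invariantLightSets_le g)
    rw [mem_invariantLightSets] at hS ⊢
    exact ⟨hS.1, fun u v huv => hS.2 u v (congrArg Subtype.val huv)⟩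

lemma sum_tsub_le_tsub {ι : Type*} (s : Finset ι) (x : ι → ℕ) (D : ℕ) :
    ∑ i ∈ s, (x i - D) ≤ (∑ i ∈ s, x i) - D := by
  classical
  induction s using Finset.induction_on with
  | empty => simp
  | insert a s ha ih =>
    rw [sum_insert ha, sum_insert ha]
    omega

omit [DecidableEq V] in
lemma sum_tsub_add_one_le (f : V → ℕ) (S : Finset V)
    (hf : ∀ u v, f u = f v → (u ∈ S ↔ v ∈ S)) (D : ℕ) :
    ∑ a ∈ S.image f, ((univ.filter (f · = a)).card - D) ≤ S.card - D := by
  refine (sum_tsub_le_tsub _ _ D).trans (Nat.sub_le_sub_right ?_ D)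
  rw [card_eq_sum_card_image f S]
  refine sum_le_sum fun a ha => card_le_card fun v hv => ?_
  obtain ⟨u, hu, rfl⟩ := mem_image.1 ha
  rw [mem_filter] at hv ⊢
  exact ⟨(hf v u hv.2).2 hu, hv.2⟩

end Induction

/-- The coefficient in the linear bound for the number of light sets. -/
def lightCoeff (k : ℕ) : ℕ :=
  2 * ((k * (3 * k) + 1) ^ (3 * k) + 3 * k * (2 * k ^ 2 * (3 * k) + 1) ^ (3 * k))

lemma ColouringBound.card_lightSets_le_aux {k : ℕ} {L : ℝ} (hk : 2 ≤ k) (hL : 0 < L) (N : ℕ) :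
    ∀ (V : Type*) [Fintype V] [DecidableEq V] (w : V → V → ℝ), Fintype.card V = N →
      ColouringBound w k L → (∀ u v, 0 ≤ w u v) →
      (lightSets w k L).card ≤ lightCoeff k * ((N - 3 * k) + 1) := by
  induction N using Nat.strong_induction_on with
  | _ N ih =>
    intro V _ _ w hN h hw
    by_cases hs : ∀ S ∈ lightSets w k L, S.card ≤ 3 * k ∨ Sᶜ.card ≤ 3 * k
    · refine (h.card_lightSets_le_of_small hw hk hL (3 * k) hs).trans ?_
      rw [hN, lightCoeff, mul_assoc 2 _ (N - _ + 1)]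
      refine Nat.mul_le_mul_left 2 ?_
      rw [add_mul]
      refine add_le_add (Nat.le_mul_of_pos_right _ (by omega)) ?_
      rw [mul_right_comm (3 * k)]
      refine Nat.mul_le_mul_right _ ?_
      rcases le_total N (3 * k) with hle | hle
      · exact hle.trans (Nat.le_mul_of_pos_right _ (by omega))
      · have : N - 3 * k ≤ 3 * k * (N - 3 * k) := Nat.le_mul_of_pos_left _ (by omega)
        rw [mul_add, mul_one]
        omega
    · push Not at hs
      obtain ⟨S₁, hS₁, hc, hc'⟩ := hs
      obtain ⟨x, hx⟩ := card_pos.1 (by omega : 0 < S₁.card)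
      obtain ⟨y, hy⟩ := card_pos.1 (by omega : 0 < S₁ᶜ.card)
      obtain ⟨f, hq, href, hF⟩ := h.exists_colouring hw hk hS₁ hx (mem_compl.1 hy)
      set q := (univ.image f).card with hqdef
      have hadd : S₁.card + S₁ᶜ.card = N := by rw [card_add_card_compl, hN]
      have href' : ∀ u v, f u = f v → (u ∈ S₁ᶜ ↔ v ∈ S₁ᶜ) := by
        intro u v huv
        rw [mem_compl, mem_compl, href u v huv]
      have hI : univ.image f = S₁.image f ∪ S₁ᶜ.image f := by
        rw [← image_union, union_compl]
      have hdisj : Disjoint (S₁.image f) (S₁ᶜ.image f) := by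
        rw [disjoint_left]
        intro a ha ha'
        obtain ⟨u, hu, rfl⟩ := mem_image.1 ha
        obtain ⟨v, hv, huv⟩ := mem_image.1 ha'
        exact (mem_compl.1 hv) ((href v u huv).2 hu)
      set c : ℕ → ℕ := fun a => (univ.filter (f · = a)).card with hcdef
      have hcle : ∀ a ∈ univ.image f, c a + 3 * k < N := by
        intro a ha
        rw [hI, mem_union] at ha
        have hclass : ∀ T : Finset V, (∀ u v, f u = f v → (u ∈ T ↔ v ∈ T)) →
            a ∈ T.image f → c a ≤ T.card := by
          intro T hT haT
          obtain ⟨u, hu, rfl⟩ := mem_image.1 haT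
          refine card_le_card fun v hv => ?_
          exact (hT v u (mem_filter.1 hv).2).2 hu
        rcases ha with ha | ha
        · have := hclass _ href ha
          omega
        · have := hclass _ href' ha
          omega
      have hbound : ∀ a ∈ univ.image f, (invariantLightSets w k L (contractOthers f a)).card ≤
          lightCoeff k * ((c a - (3 * k + 1 - q)) + 1) := by
        intro a ha
        obtain ⟨U, _, _, w', hU, hw', h', hle⟩ := h.exists_contraction hw f ha
        have := hcle a ha
        have hca : c a = (univ.filter (f · = a)).card := rfl
        have h1 := ih _ (by omega) U w' rfl h' hw'
        refine hle.trans (h1.trans (Nat.mul_le_mul_left _ ?_))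
        have : 0 < q := card_pos.2 ⟨a, ha⟩
        omega
      have hcover : lightSets w k L ⊆ (univ.image f).biUnion fun a =>
          invariantLightSets w k L (contractOthers f a) := by
        intro S hS
        obtain ⟨a, ha, hSa⟩ := hF S hS
        refine mem_biUnion.2 ⟨a, ha, mem_invariantLightSets.2 ⟨hS, fun u v huv => ?_⟩⟩
        rcases eq_of_contractOthers_eq huv with rfl | ⟨h1, h2⟩
        exacts [Iff.rfl, hSa u v h1 h2]
      refine (card_le_card hcover).trans (card_biUnion_le.trans ((sum_le_sum hbound).trans ?_))
      rw [← mul_sum]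
      refine Nat.mul_le_mul_left _ ?_
      rw [sum_add_distrib, sum_const, smul_eq_mul, mul_one, ← hqdef, hI, sum_union hdisj]
      have h1 := sum_tsub_add_one_le f S₁ href (3 * k + 1 - q)
      have h2 := sum_tsub_add_one_le f S₁ᶜ href' (3 * k + 1 - q)
      simp only [hcdef]
      omega

/-- The number of light sets is at most linear in the number of vertices. -/
lemma ColouringBound.card_lightSets_le {V : Type*} [Fintype V] [DecidableEq V] [Nonempty V]
    {w : V → V → ℝ} {k : ℕ} {L : ℝ} (h : ColouringBound w k L) (hw : ∀ u v, 0 ≤ w u v)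
    (hk : 2 ≤ k) (hL : 0 < L) : (lightSets w k L).card ≤ lightCoeff k * Fintype.card V := by
  refine (card_lightSets_le_aux hk hL _ V w rfl h hw).trans (Nat.mul_le_mul_left _ ?_)
  have := Fintype.card_pos (α := V)
  omega

section Percolation

variable {E : Type*} [Fintype E] [DecidableEq E]

/-- The probability that `ω` is the set of open elements at time `t`, when each `e` opens
independently at rate `r e`. -/
noncomputable def openProb (r : E → ℝ) (t : ℝ) (ω : Finset E) : ℝ :=
  ∏ e, if e ∈ ω then 1 - Real.exp (-(r e * t)) else Real.exp (-(r e * t))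

/-- The expectation of `f` over the random set of open elements at time `t`. -/
noncomputable def openMean (r : E → ℝ) (t : ℝ) (f : Finset E → ℝ) : ℝ :=
  ∑ ω, openProb r t ω * f ω

variable {r : E → ℝ} {t : ℝ}

lemma openProb_nonneg (hr : ∀ e, 0 ≤ r e) (ht : 0 ≤ t) (ω : Finset E) : 0 ≤ openProb r t ω := by
  refine prod_nonneg fun e _ => ?_
  split_ifs
  · have := Real.exp_le_one_iff.2 (neg_nonpos.2 (mul_nonneg (hr e) ht))
    linarith
  · exact (Real.exp_pos _).le

lemma sum_openProb (r : E → ℝ) (t : ℝ) : ∑ ω, openProb r t ω = 1 := by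
  have h := prod_add (fun e => 1 - Real.exp (-(r e * t))) (fun e => Real.exp (-(r e * t))) univ
  simp only [sub_add_cancel, prod_const_one, powerset_univ] at h
  rw [h]
  refine sum_congr rfl fun ω _ => ?_
  rw [openProb, prod_ite, filter_mem_eq_inter, univ_inter, ← filter_notMem_eq_sdiff]

lemma openMean_mono (hr : ∀ e, 0 ≤ r e) (ht : 0 ≤ t) {f g : Finset E → ℝ}
    (h : ∀ ω, f ω ≤ g ω) : openMean r t f ≤ openMean r t g :=
  sum_le_sum fun ω _ => mul_le_mul_of_nonneg_left (h ω) (openProb_nonneg hr ht ω)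

lemma openMean_const (r : E → ℝ) (t c : ℝ) : openMean r t (fun _ => c) = c := by
  rw [openMean, ← sum_mul, sum_openProb, one_mul]

lemma openMean_add (r : E → ℝ) (t : ℝ) (f g : Finset E → ℝ) :
    openMean r t (fun ω => f ω + g ω) = openMean r t f + openMean r t g := by
  simp only [openMean, mul_add, sum_add_distrib]

lemma openMean_const_mul (r : E → ℝ) (t c : ℝ) (f : Finset E → ℝ) :
    openMean r t (fun ω => c * f ω) = c * openMean r t f := by
  simp only [openMean, mul_sum]
  exact sum_congr rfl fun ω _ => by ring

lemma openMean_sum {ι : Type*} (r : E → ℝ) (t : ℝ) (s : Finset ι) (f : ι → Finset E → ℝ) :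
    openMean r t (fun ω => ∑ i ∈ s, f i ω) = ∑ i ∈ s, openMean r t (f i) := by
  simp only [openMean, mul_sum]
  exact sum_comm

lemma openProb_disjoint (r : E → ℝ) (t : ℝ) (D ω : Finset E) :
    (if Disjoint ω D then openProb r t ω else 0) =
      Real.exp (-((∑ e ∈ D, r e) * t)) * openProb (fun e => if e ∈ D then 0 else r e) t ω := by
  split_ifs with h
  · have hD : Real.exp (-((∑ e ∈ D, r e) * t)) =
        ∏ e, if e ∈ D then Real.exp (-(r e * t)) else 1 := by
      rw [prod_ite_mem, univ_inter, ← Real.exp_sum, sum_neg_distrib, sum_mul]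
    rw [hD, openProb, openProb, ← prod_mul_distrib]
    refine prod_congr rfl fun e _ => ?_
    by_cases he : e ∈ D
    · have : e ∉ ω := disjoint_right.1 h he
      simp [he, this]
    · simp [he]
  · obtain ⟨e, he, heD⟩ := not_disjoint_iff.1 h
    rw [openProb, prod_eq_zero (mem_univ e) (by simp [he, heD]), mul_zero]

/-- Conditioning on the elements of `D` being closed. -/
lemma openMean_disjoint (r : E → ℝ) (t : ℝ) (D : Finset E) (f : Finset E → ℝ) :
    openMean r t (fun ω => if Disjoint ω D then f ω else 0) =
      Real.exp (-((∑ e ∈ D, r e) * t)) *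
        openMean (fun e => if e ∈ D then 0 else r e) t f := by
  simp only [openMean, mul_sum]
  refine sum_congr rfl fun ω _ => ?_
  rw [← mul_assoc, ← openProb_disjoint]
  split_ifs <;> simp

lemma sum_finset_eq_sum_insert (e : E) (F : Finset E → ℝ) :
    ∑ ω, F ω = ∑ ω ∈ (univ.erase e).powerset, (F ω + F (insert e ω)) := by
  rw [sum_add_distrib, ← sum_powerset_insert (notMem_erase e univ),
    insert_erase (mem_univ e), powerset_univ]

lemma openProb_eq_mul_erase (r : E → ℝ) (t : ℝ) (e : E) (ω : Finset E) :
    openProb r t ω = (if e ∈ ω then 1 - Real.exp (-(r e * t)) else Real.exp (-(r e * t))) *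
      ∏ i ∈ univ.erase e,
        if i ∈ ω then 1 - Real.exp (-(r i * t)) else Real.exp (-(r i * t)) :=
  (mul_prod_erase univ _ (mem_univ e)).symm

lemma hasDerivAt_exp_neg_mul (c t : ℝ) :
    HasDerivAt (fun t => Real.exp (-(c * t))) (Real.exp (-(c * t)) * -c) t :=
  ((hasDerivAt_const_mul c).fun_neg).exp

/-- Russo's formula for expectations. -/
lemma hasDerivAt_openMean (r : E → ℝ) (t : ℝ) (f : Finset E → ℝ) :
    HasDerivAt (fun t => openMean r t f)
      (openMean r t fun ω => ∑ e, r e * (f (insert e ω) - f ω)) t := by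
  set p : ℝ → Finset E → E → ℝ := fun t ω e =>
    if e ∈ ω then 1 - Real.exp (-(r e * t)) else Real.exp (-(r e * t)) with hp
  set p' : Finset E → E → ℝ := fun ω e =>
    if e ∈ ω then r e * Real.exp (-(r e * t)) else -(r e * Real.exp (-(r e * t))) with hp'
  have h1 : ∀ ω e, HasDerivAt (fun t => p t ω e) (p' ω e) t := by
    intro ω e
    have h0 : HasDerivAt (fun t => Real.exp (-(r e * t))) (-(r e * Real.exp (-(r e * t)))) t := by
      convert hasDerivAt_exp_neg_mul (r e) t using 1
      ring
    simp only [hp, hp']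
    split_ifs
    · simpa using h0.const_sub 1
    · exact h0
  have h2 : ∀ ω, HasDerivAt (fun t => openProb r t ω)
      (∑ e, (∏ i ∈ univ.erase e, p t ω i) * p' ω e) t := by
    intro ω
    have := HasDerivAt.fun_finsetProd (u := univ) fun e _ => h1 ω e
    simp only [smul_eq_mul] at this
    exact this
  have h3 : HasDerivAt (fun t => openMean r t f)
      (∑ ω, (∑ e, (∏ i ∈ univ.erase e, p t ω i) * p' ω e) * f ω) t :=
    HasDerivAt.fun_sum fun ω _ => (h2 ω).mul_const (f ω)
  convert h3 using 1
  rw [openMean_sum]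
  simp only [sum_mul]
  rw [sum_comm]
  refine sum_congr rfl fun e _ => ?_
  rw [openMean, sum_finset_eq_sum_insert e, sum_finset_eq_sum_insert e]
  refine sum_congr rfl fun ω hω => ?_
  have heω : e ∉ ω := fun h => notMem_erase e univ (mem_powerset.1 hω h)
  have h4 : ∏ i ∈ univ.erase e, p t (insert e ω) i = ∏ i ∈ univ.erase e, p t ω i := by
    refine prod_congr rfl fun i hi => ?_
    simp [hp, ne_of_mem_erase hi]
  rw [h4, openProb_eq_mul_erase r t e ω]
  simp only [hp, hp', heω, mem_insert_self, insert_idem, if_true, if_false]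
  ring

end Percolation

/-- A Grönwall-type bound. -/
lemma le_of_hasDerivAt_le {y y' : ℝ → ℝ} {A B ε T : ℝ} (hA : 0 ≤ A) (hε : 0 < ε) (hT : 0 ≤ T)
    (hB : 0 ≤ B) (hy : ∀ t, HasDerivAt y (y' t) t)
    (h : ∀ t, 0 ≤ t → y' t ≤ -y t + A + B * Real.exp (-((1 + ε) * t))) :
    y T ≤ A + Real.exp (-T) * (y 0 + B / ε) := by
  set g : ℝ → ℝ := fun t => Real.exp t * (y t - A) + B / ε * Real.exp (-(ε * t)) with hg
  set g' : ℝ → ℝ := fun t =>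
    Real.exp t * (y t - A) + Real.exp t * y' t + B / ε * (Real.exp (-(ε * t)) * -ε) with hg'
  have hderiv : ∀ t, HasDerivAt g (g' t) t := by
    intro t
    have h1 := (Real.hasDerivAt_exp t).mul ((hy t).sub_const A)
    exact h1.add ((hasDerivAt_exp_neg_mul ε t).const_mul (B / ε))
  have hanti : AntitoneOn g (Set.Ici 0) := by
    refine antitoneOn_of_deriv_nonpos (convex_Ici 0)
      (fun t _ => (hderiv t).continuousAt.continuousWithinAt)
      (fun t _ => (hderiv t).differentiableAt.differentiableWithinAt) fun t ht => ?_
    rw [interior_Ici] at ht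
    rw [(hderiv t).deriv]
    have h1 := mul_le_mul_of_nonneg_left (h t (le_of_lt ht)) (Real.exp_pos t).le
    have h2 : Real.exp t * Real.exp (-((1 + ε) * t)) = Real.exp (-(ε * t)) := by
      rw [← Real.exp_add]
      congr 1
      ring
    have h3 : B / ε * (Real.exp (-(ε * t)) * -ε) = -(B * Real.exp (-(ε * t))) := by
      field_simp
    simp only [hg', h3]
    rw [← h2]
    nlinarith
  have h0 := hanti (Set.mem_Ici.2 le_rfl) (Set.mem_Ici.2 hT) hT
  simp only [hg, mul_zero, neg_zero, Real.exp_zero, mul_one, one_mul] at h0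
  have h1 : 0 ≤ B / ε * Real.exp (-(ε * T)) := by positivity
  have h2 : Real.exp T * (y T - A) ≤ y 0 + B / ε := by linarith
  have h3 := mul_le_mul_of_nonneg_left h2 (Real.exp_pos (-T)).le
  rw [← mul_assoc, ← Real.exp_add, neg_add_cancel, Real.exp_zero, one_mul] at h3
  linarith

section Components

variable {V : Type*} [Fintype V] [DecidableEq V]

/-- The connected component of `v` when the arcs in `ω` are open. -/
noncomputable def component (ω : Finset (V × V)) (v : V) : Finset V :=
  open Classical in univ.filter fun u => Relation.EqvGen (fun a b => (a, b) ∈ ω) v u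

/-- The set of connected components when the arcs in `ω` are open. -/
noncomputable def components (ω : Finset (V × V)) : Finset (Finset V) :=
  univ.image (component ω)

variable {ω : Finset (V × V)}

omit [DecidableEq V] in
lemma mem_component {u v : V} :
    u ∈ component ω v ↔ Relation.EqvGen (fun a b => (a, b) ∈ ω) v u := by
  simp [component]

omit [DecidableEq V] in
lemma mem_component_self (ω : Finset (V × V)) (v : V) : v ∈ component ω v :=
  mem_component.2 (.refl v)

omit [DecidableEq V] in
lemma component_eq_of_mem {u v : V} (h : u ∈ component ω v) : component ω u = component ω v := by
  ext x
  rw [mem_component] at h ⊢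
  rw [mem_component]
  exact ⟨fun hx => h.trans _ _ _ hx, fun hx => h.symm.trans _ _ _ hx⟩

omit [DecidableEq V] in
lemma component_eq_of_arc {u v : V} (h : (u, v) ∈ ω) : component ω u = component ω v :=
  (component_eq_of_mem (mem_component.2 (.rel _ _ h))).symm

lemma component_mem_components (ω : Finset (V × V)) (v : V) : component ω v ∈ components ω :=
  mem_image_of_mem _ (mem_univ v)

lemma eq_component_of_mem {S : Finset V} (hS : S ∈ components ω) {v : V} (hv : v ∈ S) :
    S = component ω v := by
  obtain ⟨u, -, rfl⟩ := mem_image.1 hS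
  exact (component_eq_of_mem hv).symm

lemma nonempty_of_mem_components {S : Finset V} (hS : S ∈ components ω) : S.Nonempty := by
  obtain ⟨u, -, rfl⟩ := mem_image.1 hS
  exact ⟨u, mem_component_self ω u⟩

lemma mem_iff_component_eq {S : Finset V} (hS : S ∈ components ω) {v : V} :
    v ∈ S ↔ S = component ω v :=
  ⟨eq_component_of_mem hS, fun h => h ▸ mem_component_self ω v⟩

omit [DecidableEq V] in
lemma component_eq_of_subset {ω' : Finset (V × V)} (h : ω ⊆ ω') {u v : V}
    (huv : component ω u = component ω v) : component ω' u = component ω' v := by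
  have hu : u ∈ component ω v := huv ▸ mem_component_self ω u
  refine component_eq_of_mem (mem_component.2 ?_)
  exact (mem_component.1 hu).mono fun a b hab => h hab

lemma card_components_le (ω : Finset (V × V)) : (components ω).card ≤ Fintype.card V :=
  card_image_le

lemma biUnion_component {ω' : Finset (V × V)} (h : ω ⊆ ω') (v : V) :
    (component ω v).biUnion (component ω') = component ω' v := by
  ext x
  rw [mem_biUnion]
  constructor
  · rintro ⟨u, hu, hx⟩
    rwa [← component_eq_of_subset h (component_eq_of_mem hu)]
  · exact fun hx => ⟨v, mem_component_self ω v, hx⟩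

lemma components_eq_image_biUnion {ω' : Finset (V × V)} (h : ω ⊆ ω') :
    components ω' = (components ω).image fun S => S.biUnion (component ω') := by
  rw [components, components, image_image]
  exact image_congr fun v _ => (biUnion_component h v).symm

lemma card_components_insert_le (ω : Finset (V × V)) (e : V × V) :
    (components (insert e ω)).card + (if component ω e.1 = component ω e.2 then 0 else 1) ≤
      (components ω).card := by
  have hsub := subset_insert e ω
  have h := components_eq_image_biUnion hsub
  split_ifs with he
  · rw [h, add_zero]
    exact card_image_le
  · refine Nat.succ_le_of_lt (lt_of_le_of_ne (h ▸ card_image_le) fun heq => he ?_)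
    rw [h, card_image_iff] at heq
    refine heq (component_mem_components ω _) (component_mem_components ω _) ?_
    simp only [biUnion_component hsub]
    exact component_eq_of_arc (mem_insert_self e ω)

/-- The weights of the components sum to at most twice the weight between components. -/
lemma sum_cutWeight_components_le {w : V → V → ℝ} (hw : ∀ u v, 0 ≤ w u v)
    (ω : Finset (V × V)) :
    ∑ S ∈ components ω, cutWeight w S ≤
      2 * sepWeight w fun u v => component ω u ≠ component ω v := by
  have h1 : ∀ S ∈ components ω, cutWeight w S ≤
      (sepWeight w fun u v => u ∈ S ∧ v ∉ S) + sepWeight w fun u v => u ∉ S ∧ v ∈ S :=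
    fun S _ => sepWeight_or_le hw fun u v h => by tauto
  refine (sum_le_sum h1).trans ?_
  rw [sum_add_distrib, two_mul]
  refine add_le_add (sum_sepWeight_le hw _ _ (fun S hS u v h => ?_) fun S hS T hT u v h hb => ?_)
    (sum_sepWeight_le hw _ _ (fun S hS u v h => ?_) fun S hS T hT u v h hb => ?_)
  · rw [mem_iff_component_eq hS, mem_iff_component_eq hS] at h
    exact fun heq => h.2 (h.1.trans heq)
  · exact (eq_component_of_mem hS h.1).trans (eq_component_of_mem hT hb.1).symm
  · rw [mem_iff_component_eq hS, mem_iff_component_eq hS] at h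
    exact fun heq => h.1 (h.2.trans heq.symm)
  · exact (eq_component_of_mem hS h.2).trans (eq_component_of_mem hT hb.2).symm

/-- A component has no open arc leaving or entering it. -/
lemma disjoint_boundary_of_mem_components {S : Finset V} (hS : S ∈ components ω) :
    Disjoint ω (univ.filter fun e : V × V => ¬(e.1 ∈ S ↔ e.2 ∈ S)) := by
  rw [disjoint_left]
  intro e he he'
  refine (mem_filter.1 he').2 ?_
  rw [mem_iff_component_eq hS, mem_iff_component_eq hS, component_eq_of_arc he]

end Components

section Drift

variable {V : Type*} [Fintype V] [DecidableEq V] {w w₁ w₂ : V → V → ℝ} {k : ℕ} {L α : ℝ}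

omit [DecidableEq V] in
lemma sepWeight_add (h : ∀ u v, w u v = w₁ u v + w₂ u v) (R : V → V → Prop) :
    sepWeight w R = sepWeight w₁ R + sepWeight w₂ R := by
  classical
  unfold sepWeight
  rw [← mul_add, ← sum_add_distrib]
  simp only [← sum_add_distrib, h]
  congr 1
  refine sum_congr rfl fun u _ => sum_congr rfl fun v _ => ?_
  split_ifs <;> simp

/-- The light sets that remain fairly heavy with respect to `w₁`. -/
noncomputable def persistentSets (w w₁ : V → V → ℝ) (k : ℕ) (L : ℝ) : Finset (Finset V) :=
  open Classical in (lightSets w k L).filter fun S =>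
    1 + 1 / (2 * ((k : ℝ) - 1)) ≤ k / L * cutWeight w₁ S

omit [DecidableEq V] in
lemma mem_persistentSets {S : Finset V} : S ∈ persistentSets w w₁ k L ↔
    S ∈ lightSets w k L ∧ 1 + 1 / (2 * ((k : ℝ) - 1)) ≤ k / L * cutWeight w₁ S := by
  simp [persistentSets]

lemma card_components_le_of_light (h : ColouringBound w k L) (hk : 2 ≤ k) (hL : 0 < L)
    (hw₁ : ∀ u v, 0 ≤ w₁ u v) (hw₂ : ∀ u v, 0 ≤ w₂ u v) (hw : ∀ u v, w u v = w₁ u v + w₂ u v)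
    (hα : (sepWeight w₂ fun _ _ => True) ≤ α * L) (ω : Finset (V × V)) :
    ((components ω).card : ℝ) ≤
      k / L * (sepWeight w₁ fun u v => component ω u ≠ component ω v) +
      (α * k + (k - 1) + 4 * α * k * (k - 1)) +
      ∑ S ∈ persistentSets w w₁ k L, if S ∈ components ω then (1 : ℝ) else 0 := by
  classical
  have hw0 : ∀ u v, 0 ≤ w u v := fun u v => by
    rw [hw]
    exact add_nonneg (hw₁ u v) (hw₂ u v)
  have hk2 : (2 : ℝ) ≤ k := by exact_mod_cast hk
  set β : ℝ := k / L with hβ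
  have hβ0 : 0 < β := by positivity
  have hβL : β * L = k := by
    rw [hβ]
    field_simp
  set c : ℝ := 2 * ((k : ℝ) - 1) with hc
  have hc0 : 0 < c := by linarith
  have hpt : ∀ S ∈ components ω, (1 : ℝ) ≤ β / 2 * cutWeight w S +
      (if ((k : ℝ) - 1) * cutWeight w S < L then 1 else 0) + c * β * cutWeight w₂ S +
      (if S ∈ persistentSets w w₁ k L then 1 else 0) := by
    intro S _
    have hadd : cutWeight w S = cutWeight w₁ S + cutWeight w₂ S := sepWeight_add hw _
    have h1 : 0 ≤ cutWeight w₁ S := cutWeight_nonneg hw₁ S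
    have h2 : 0 ≤ β * cutWeight w₂ S := mul_nonneg hβ0.le (cutWeight_nonneg hw₂ S)
    have h2' : 0 ≤ c * β * cutWeight w₂ S := by
      rw [mul_assoc]
      exact mul_nonneg hc0.le h2
    have h3 : 0 ≤ β / 2 * cutWeight w S := mul_nonneg (by linarith) (cutWeight_nonneg hw0 S)
    by_cases hlight : S ∈ lightSets w k L
    · by_cases hsmall : ((k : ℝ) - 1) * cutWeight w S < L
      · rw [if_pos hsmall]
        split_ifs <;> linarith
      · by_cases hpers : S ∈ persistentSets w w₁ k L
        · rw [if_pos hpers]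
          split_ifs
          linarith
        · rw [mem_persistentSets, not_and, not_le] at hpers
          have h4 := hpers hlight
          have h5 : (k : ℝ) ≤ (k - 1) * (β * cutWeight w S) := by
            calc (k : ℝ) = β * L := hβL.symm
              _ ≤ β * ((k - 1) * cutWeight w S) :=
                mul_le_mul_of_nonneg_left (not_lt.1 hsmall) hβ0.le
              _ = _ := by ring
          have h6 : c * (β * cutWeight w₁ S) ≤ c * (1 + 1 / c) :=
            mul_le_mul_of_nonneg_left h4.le hc0.le
          have h7 : c * (1 + 1 / c) = c + 1 := by field_simp
          have h8 : 1 ≤ c * β * cutWeight w₂ S := by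
            rw [hadd] at h5
            rw [h7] at h6
            rw [hc] at h6 ⊢
            nlinarith
          split_ifs <;> linarith
    · rw [mem_lightSets, not_lt] at hlight
      have h4 : 1 ≤ β / 2 * cutWeight w S := by
        rw [hβ, div_div, div_mul_eq_mul_div, one_le_div (by linarith)]
        linarith
      split_ifs <;> linarith
  have hsum := sum_le_sum hpt
  rw [sum_const, nsmul_eq_mul, mul_one, sum_add_distrib, sum_add_distrib, sum_add_distrib,
    ← mul_sum, ← mul_sum, sum_boole, sum_boole] at hsum
  have hsmall : (((components ω).filter fun S => ((k : ℝ) - 1) * cutWeight w S < L).card : ℝ) ≤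
      (k : ℝ) - 1 := by
    have := h.card_le_of_disjoint hw0 hk
      ((components ω).filter fun S => ((k : ℝ) - 1) * cutWeight w S < L)
      (fun A hA => nonempty_of_mem_components (mem_filter.1 hA).1)
      (fun A hA B hB x hxA hxB => (eq_component_of_mem (mem_filter.1 hA).1 hxA).trans
        (eq_component_of_mem (mem_filter.1 hB).1 hxB).symm) fun A hA => (mem_filter.1 hA).2
    have h' : (((components ω).filter fun S => ((k : ℝ) - 1) * cutWeight w S < L).card : ℝ) ≤
      (k - 1 : ℕ) := by exact_mod_cast this
    rwa [Nat.cast_sub (by omega), Nat.cast_one] at h'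
  have hpers : (((components ω).filter (· ∈ persistentSets w w₁ k L)).card : ℝ) =
      ∑ S ∈ persistentSets w w₁ k L, if S ∈ components ω then (1 : ℝ) else 0 := by
    rw [sum_boole, filter_mem_eq_inter, filter_mem_eq_inter, inter_comm]
  have hsplit : ∑ S ∈ components ω, cutWeight w S =
      ∑ S ∈ components ω, cutWeight w₁ S + ∑ S ∈ components ω, cutWeight w₂ S := by
    rw [← sum_add_distrib]
    exact sum_congr rfl fun S _ => sepWeight_add hw _
  have hs₁ := sum_cutWeight_components_le hw₁ ω
  have hs₂ : ∑ S ∈ components ω, cutWeight w₂ S ≤ 2 * (α * L) :=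
    (sum_cutWeight_components_le hw₂ ω).trans
      (mul_le_mul_of_nonneg_left ((sepWeight_mono hw₂ fun _ _ _ => trivial).trans hα) (by norm_num))
  rw [← hpers]
  have h9 := mul_le_mul_of_nonneg_left hs₁ hβ0.le
  have h10 := mul_le_mul_of_nonneg_left hs₂ hβ0.le
  have h11 := mul_le_mul_of_nonneg_left h10 hc0.le
  have h12 : β * (2 * (α * L)) = 2 * α * k := by
    rw [← hβL]
    ring
  rw [h12] at h10 h11
  have h13 : c * (2 * α * k) = 4 * α * k * (k - 1) := by
    rw [hc]
    ring
  rw [h13] at h11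
  rw [hsplit] at hsum
  linarith

end Drift

section MeanBound

variable {V : Type*} [Fintype V] [DecidableEq V] {w w₁ w₂ : V → V → ℝ} {k : ℕ} {L α : ℝ}

/-- The rates at which arcs open: `k / (2 * L)` times their weight. -/
noncomputable def arcRate (w : V → V → ℝ) (k : ℕ) (L : ℝ) (e : V × V) : ℝ :=
  k / (2 * L) * w e.1 e.2

omit [Fintype V] [DecidableEq V] in
lemma arcRate_nonneg (hw : ∀ u v, 0 ≤ w u v) (hL : 0 < L) (e : V × V) : 0 ≤ arcRate w k L e :=
  mul_nonneg (by positivity) (hw _ _)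

omit [DecidableEq V] in
open Classical in
lemma sum_arcRate (w : V → V → ℝ) (k : ℕ) (L : ℝ) (R : V → V → Prop) :
    (∑ e : V × V, if R e.1 e.2 then arcRate w k L e else 0) = k / L * sepWeight w R := by
  unfold sepWeight arcRate
  rw [Fintype.sum_prod_type, ← mul_assoc, mul_sum]
  refine sum_congr rfl fun u _ => ?_
  rw [mul_sum]
  refine sum_congr rfl fun v _ => ?_
  split_ifs
  · ring
  · simp

lemma openMean_mem_components_le (hw : ∀ u v, 0 ≤ w u v) (hL : 0 < L) {t : ℝ} (ht : 0 ≤ t)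
    (S : Finset V) :
    openMean (arcRate w k L) t (fun ω => if S ∈ components ω then 1 else 0) ≤
      Real.exp (-((k / L * cutWeight w S) * t)) := by
  classical
  set D : Finset (V × V) := univ.filter fun e => ¬(e.1 ∈ S ↔ e.2 ∈ S) with hD
  calc _ ≤ openMean (arcRate w k L) t fun ω => if Disjoint ω D then 1 else 0 := by
        refine openMean_mono (arcRate_nonneg hw hL) ht fun ω => ?_
        by_cases hS : S ∈ components ω
        · rw [if_pos hS, if_pos (disjoint_boundary_of_mem_components hS)]
        · rw [if_neg hS]
          split_ifs <;> norm_num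
    _ = _ := by
        rw [openMean_disjoint, openMean_const, mul_one, cutWeight, ← sum_arcRate, hD, sum_filter]
        congr! 5

/-- The expected drift of the number of components. -/
lemma openMean_drift_le [Nonempty V] (h : ColouringBound w k L) (hk : 2 ≤ k) (hL : 0 < L)
    (hw₁ : ∀ u v, 0 ≤ w₁ u v) (hw₂ : ∀ u v, 0 ≤ w₂ u v) (hw : ∀ u v, w u v = w₁ u v + w₂ u v)
    (hα : (sepWeight w₂ fun _ _ => True) ≤ α * L) {t : ℝ} (ht : 0 ≤ t) :
    (openMean (arcRate w₁ k L) t fun ω => ∑ e, arcRate w₁ k L e *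
        (((components (insert e ω)).card : ℝ) - (components ω).card)) ≤
      -(openMean (arcRate w₁ k L) t fun ω => ((components ω).card : ℝ)) +
        (α * k + (k - 1) + 4 * α * k * (k - 1)) +
        lightCoeff k * Fintype.card V * Real.exp (-((1 + 1 / (2 * ((k : ℝ) - 1))) * t)) := by
  classical
  set r := arcRate w₁ k L with hr
  set A : ℝ := α * k + (k - 1) + 4 * α * k * (k - 1) with hA
  have hr0 : ∀ e, 0 ≤ r e := arcRate_nonneg hw₁ hL
  have hpt : ∀ ω : Finset (V × V), (∑ e, r e *
        (((components (insert e ω)).card : ℝ) - (components ω).card)) ≤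
      ((-1) * ((components ω).card : ℝ) + A) +
        ∑ S ∈ persistentSets w w₁ k L, if S ∈ components ω then (1 : ℝ) else 0 := by
    intro ω
    have h1 : (∑ e, r e * (((components (insert e ω)).card : ℝ) - (components ω).card)) ≤
        -∑ e : V × V, if component ω e.1 ≠ component ω e.2 then r e else 0 := by
      rw [← sum_neg_distrib]
      refine sum_le_sum fun e _ => ?_
      have h2 : (((components (insert e ω)).card +
        (if component ω e.1 = component ω e.2 then 0 else 1) : ℕ) : ℝ) ≤ (components ω).card :=
        Nat.cast_le.2 (card_components_insert_le ω e)
      by_cases he : component ω e.1 = component ω e.2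
      · rw [if_pos he] at h2
        rw [if_neg (not_not.2 he), neg_zero]
        push_cast at h2
        exact mul_nonpos_of_nonneg_of_nonpos (hr0 e) (by linarith)
      · rw [if_neg he] at h2
        rw [if_pos he]
        push_cast at h2
        nlinarith [hr0 e]
    have h3 := sum_arcRate w₁ k L fun u v => component ω u ≠ component ω v
    have h4 := card_components_le_of_light h hk hL hw₁ hw₂ hw hα ω
    have h5 : (∑ e : V × V, if component ω e.1 ≠ component ω e.2 then r e else 0) =
        k / L * sepWeight w₁ fun u v => component ω u ≠ component ω v := by
      rw [← h3]
      exact sum_congr rfl fun e _ => by congr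
    rw [h5] at h1
    linarith
  refine (openMean_mono hr0 ht hpt).trans ?_
  rw [openMean_add, openMean_add, openMean_const, openMean_const_mul, openMean_sum]
  have hS : (∑ S ∈ persistentSets w w₁ k L,
      openMean r t fun ω => if S ∈ components ω then (1 : ℝ) else 0) ≤
      lightCoeff k * Fintype.card V * Real.exp (-((1 + 1 / (2 * ((k : ℝ) - 1))) * t)) := by
    calc _ ≤ ∑ S ∈ persistentSets w w₁ k L,
          Real.exp (-((1 + 1 / (2 * ((k : ℝ) - 1))) * t)) := by
          refine sum_le_sum fun S hS => (openMean_mem_components_le hw₁ hL ht S).trans ?_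
          rw [Real.exp_le_exp, neg_le_neg_iff]
          exact mul_le_mul_of_nonneg_right (mem_persistentSets.1 hS).2 ht
      _ ≤ _ := by
          rw [sum_const, nsmul_eq_mul]
          refine mul_le_mul_of_nonneg_right ?_ (Real.exp_pos _).le
          have hw0 : ∀ u v, 0 ≤ w u v := fun u v => by
            rw [hw]
            exact add_nonneg (hw₁ u v) (hw₂ u v)
          have h6 : (persistentSets w w₁ k L).card ≤ lightCoeff k * Fintype.card V :=
            (card_le_card fun S hS => (mem_persistentSets.1 hS).1).trans
              (h.card_lightSets_le hw0 hk hL)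
          exact_mod_cast h6
  linarith

/-- The time at which the random contraction is stopped. -/
noncomputable def stopTime (k n : ℕ) : ℝ :=
  Real.log (n * (1 + 2 * k * lightCoeff k))

lemma stopTime_nonneg {k n : ℕ} (hn : 0 < n) : 0 ≤ stopTime k n := by
  refine Real.log_nonneg ?_
  have : (1 : ℝ) ≤ n := by exact_mod_cast hn
  have h2 : (0 : ℝ) ≤ 2 * k * lightCoeff k := by positivity
  nlinarith

lemma openMean_card_components_le [Nonempty V] (h : ColouringBound w k L) (hk : 2 ≤ k)
    (hL : 0 < L) (hw₁ : ∀ u v, 0 ≤ w₁ u v) (hw₂ : ∀ u v, 0 ≤ w₂ u v)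
    (hw : ∀ u v, w u v = w₁ u v + w₂ u v) (h1α : 1 ≤ α)
    (hα : (sepWeight w₂ fun _ _ => True) ≤ α * L) :
    (openMean (arcRate w₁ k L) (stopTime k (Fintype.card V))
      fun ω => ((components ω).card : ℝ)) ≤ 4 * α * k ^ 2 := by
  have hn : 0 < Fintype.card V := Fintype.card_pos
  have hn' : (0 : ℝ) < Fintype.card V := by exact_mod_cast hn
  have hk2 : (2 : ℝ) ≤ k := by exact_mod_cast hk
  set T := stopTime k (Fintype.card V) with hT
  have hT0 : 0 ≤ T := stopTime_nonneg hn
  have hA0 : 0 ≤ α * k + (k - 1) + 4 * α * k * ((k : ℝ) - 1) := by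
    have h1 : 0 ≤ (k : ℝ) - 1 := by linarith
    have h2 : 0 ≤ α := by linarith
    positivity
  have hε : 0 < 1 / (2 * ((k : ℝ) - 1)) := by
    apply one_div_pos.2
    linarith
  have key := le_of_hasDerivAt_le (B := lightCoeff k * Fintype.card V) hA0 hε hT0 (by positivity)
    (hasDerivAt_openMean (arcRate w₁ k L) · fun ω => ((components ω).card : ℝ))
    fun t ht => openMean_drift_le h hk hL hw₁ hw₂ hw hα ht
  refine key.trans ?_
  have hy0 : (openMean (arcRate w₁ k L) 0 fun ω => ((components ω).card : ℝ)) ≤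
      Fintype.card V := by
    refine (openMean_mono (arcRate_nonneg hw₁ hL) le_rfl
      fun ω => Nat.cast_le.2 (card_components_le ω)).trans_eq ?_
    rw [openMean_const]
  have hexp : Real.exp (-T) * (Fintype.card V * (1 + 2 * k * lightCoeff k)) = 1 := by
    have hpos : (0 : ℝ) < Fintype.card V * (1 + 2 * k * lightCoeff k) := by positivity
    rw [hT, stopTime, Real.exp_neg, Real.exp_log hpos, inv_mul_cancel₀ hpos.ne']
  have hB : lightCoeff k * (Fintype.card V : ℝ) / (1 / (2 * ((k : ℝ) - 1))) ≤
      Fintype.card V * (2 * k * lightCoeff k) := by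
    rw [div_div_eq_mul_div, div_one]
    have : (0 : ℝ) ≤ lightCoeff k * Fintype.card V := by positivity
    nlinarith
  have h1 : Real.exp (-T) * ((openMean (arcRate w₁ k L) 0 fun ω => ((components ω).card : ℝ)) +
      lightCoeff k * (Fintype.card V : ℝ) / (1 / (2 * ((k : ℝ) - 1)))) ≤ 1 := by
    refine le_trans ?_ hexp.le
    exact mul_le_mul_of_nonneg_left (by linarith) (Real.exp_pos _).le
  nlinarith

/-- With probability at least one half, few components remain. -/
lemma half_le_openMean_few [Nonempty V] (h : ColouringBound w k L) (hk : 2 ≤ k)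
    (hL : 0 < L) (hw₁ : ∀ u v, 0 ≤ w₁ u v) (hw₂ : ∀ u v, 0 ≤ w₂ u v)
    (hw : ∀ u v, w u v = w₁ u v + w₂ u v) (h1α : 1 ≤ α)
    (hα : (sepWeight w₂ fun _ _ => True) ≤ α * L) :
    1 / 2 ≤ openMean (arcRate w₁ k L) (stopTime k (Fintype.card V))
      fun ω => if ((components ω).card : ℝ) ≤ 8 * α * k ^ 2 then 1 else 0 := by
  have hn : 0 < Fintype.card V := Fintype.card_pos
  have hk2 : (2 : ℝ) ≤ k := by exact_mod_cast hk
  have hR : 0 < 8 * α * (k : ℝ) ^ 2 := by positivity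
  have hmean := openMean_card_components_le h hk hL hw₁ hw₂ hw h1α hα
  have hmono := openMean_mono (arcRate_nonneg (k := k) hw₁ hL)
    (stopTime_nonneg (k := k) hn)
    (f := fun ω => 1 + (-(1 / (8 * α * (k : ℝ) ^ 2))) * ((components ω).card : ℝ))
    (g := fun ω => if ((components ω).card : ℝ) ≤ 8 * α * k ^ 2 then 1 else 0) fun ω => by
      have h0 : 0 ≤ 1 / (8 * α * (k : ℝ) ^ 2) * ((components ω).card : ℝ) := by positivity
      split_ifs with hω
      · linarith
      · rw [not_le] at hω
        have : 1 < 1 / (8 * α * (k : ℝ) ^ 2) * ((components ω).card : ℝ) := by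
          rwa [one_div_mul_eq_div, one_lt_div hR]
        linarith
  rw [openMean_add, openMean_const, openMean_const_mul] at hmono
  refine le_trans ?_ hmono
  have := mul_le_mul_of_nonneg_left hmean (one_div_pos.2 hR).le
  have h2 : 1 / (8 * α * (k : ℝ) ^ 2) * (4 * α * k ^ 2) = 1 / 2 := by
    field_simp
    norm_num
  linarith

end MeanBound

section Partitions

variable {V : Type*} [Fintype V] [DecidableEq V] {k : ℕ}

lemma card_image_le_card_image_of_factorsThrough {α β γ : Type*} [DecidableEq β] [DecidableEq γ]
    [Nonempty β] (s : Finset α) {f : α → β} {g : α → γ} (h : f.FactorsThrough g) :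
    (s.image f).card ≤ (s.image g).card := by
  rw [← h.extend_comp (fun _ => Classical.arbitrary β), ← image_image]
  exact card_image_le

lemma Finpartition.exists_parts_iff_part_eq (P : Finpartition (univ : Finset V)) (u v : V) :
    (∃ p ∈ P.parts, u ∈ p ∧ v ∈ p) ↔ P.part u = P.part v := by
  rw [← P.mem_part_iff_exists, P.mem_part_iff_part_eq_part (mem_univ _) (mem_univ _)]

lemma kCutWeight_eq_sepWeight (w : V → V → ℝ) (P : Finpartition (univ : Finset V)) :
    kCutWeight w P = sepWeight w fun u v => P.part u ≠ P.part v := by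
  unfold kCutWeight sepWeight
  congr 1
  refine sum_congr rfl fun u _ => sum_congr rfl fun v _ => ?_
  by_cases h : P.part u = P.part v
  · rw [if_pos ((P.exists_parts_iff_part_eq u v).2 h), if_neg (not_not.2 h)]
  · rw [if_neg (mt (P.exists_parts_iff_part_eq u v).1 h), if_pos h]

lemma Finpartition.image_part_univ (P : Finpartition (univ : Finset V)) :
    univ.image P.part = P.parts := by
  ext S
  rw [mem_image]
  constructor
  · rintro ⟨v, hv, rfl⟩
    exact P.part_mem.2 hv
  · intro hS
    obtain ⟨v, hv⟩ := P.nonempty_of_mem_parts hS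
    exact ⟨v, mem_univ v, P.part_eq_of_mem hS hv⟩

lemma Finpartition.exists_colouring (P : Finpartition (univ : Finset V)) (hP : P.parts.card = k) :
    ∃ φ : V → Fin k, ∀ u v, φ u = φ v ↔ P.part u = P.part v := by
  refine ⟨fun v => P.parts.equivFinOfCardEq hP ⟨P.part v, P.part_mem.2 (mem_univ v)⟩,
    fun u v => ?_⟩
  rw [EmbeddingLike.apply_eq_iff_eq, Subtype.mk.injEq]

lemma Finpartition.ext_part {P Q : Finpartition (univ : Finset V)}
    (h : ∀ u v, P.part u = P.part v ↔ Q.part u = Q.part v) : P = Q := by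
  have hpart : P.part = Q.part := by
    ext u v
    rw [P.mem_part_iff_part_eq_part (mem_univ _) (mem_univ _),
      Q.mem_part_iff_part_eq_part (mem_univ _) (mem_univ _), h]
  refine Finpartition.ext ?_
  rw [← P.image_part_univ, ← Q.image_part_univ, hpart]

/-- A lower bound for the weight of all `k`-cuts bounds all colourings with at least `k`
colours. -/
lemma colouringBound_of_le_kCutWeight {w : V → V → ℝ} {L : ℝ} (hw : ∀ u v, 0 ≤ w u v)
    (hk : 0 < k)
    (h : ∀ P : Finpartition (univ : Finset V), P.parts.card = k → L ≤ kCutWeight w P) :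
    ColouringBound w k L := by
  classical
  intro f hf
  obtain ⟨t, ht, htk⟩ := exists_subset_card_eq hf
  have : Nonempty (Fin k) := ⟨⟨0, hk⟩⟩
  let e := t.equivFinOfCardEq htk
  let g : ℕ → Fin k := fun x => if hx : x ∈ t then e ⟨x, hx⟩ else Classical.arbitrary _
  let P := Finpartition.ofSetoid (Setoid.ker (g ∘ f))
  have hP : ∀ u v, P.part u = P.part v ↔ g (f u) = g (f v) := fun u v => by
    rw [← P.mem_part_iff_part_eq_part (mem_univ _) (mem_univ _),
      Finpartition.mem_part_ofSetoid_iff_rel, Setoid.ker_def]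
    exact eq_comm
  have hsurj : univ.image (g ∘ f) = univ := by
    refine eq_univ_of_forall fun c => ?_
    obtain ⟨v, -, hv⟩ := mem_image.1 (ht (e.symm c).2)
    refine mem_image.2 ⟨v, mem_univ v, ?_⟩
    simp [g, hv]
  have hcard : P.parts.card = k := by
    rw [← P.image_part_univ]
    have hk' : (univ.image (g ∘ f)).card = k := by rw [hsurj, card_univ, Fintype.card_fin]
    refine le_antisymm ?_ ?_
    · exact (card_image_le_card_image_of_factorsThrough univ
        (fun u v huv => (hP u v).2 huv)).trans_eq hk'
    · exact hk'.ge.trans (card_image_le_card_image_of_factorsThrough univ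
        fun u v huv => (hP u v).1 huv)
  refine (h P hcard).trans ?_
  rw [kCutWeight_eq_sepWeight]
  exact sepWeight_mono hw fun u v huv heq => huv ((hP u v).2 (congrArg g heq))

/-- The arcs between different parts of `P`. -/
def Finpartition.cutArcs (P : Finpartition (univ : Finset V)) : Finset (V × V) :=
  univ.filter fun e => P.part e.1 ≠ P.part e.2

lemma Finpartition.mem_cutArcs {P : Finpartition (univ : Finset V)} {e : V × V} :
    e ∈ P.cutArcs ↔ P.part e.1 ≠ P.part e.2 := by
  simp [cutArcs]

lemma Finpartition.part_eq_of_component_eq {P : Finpartition (univ : Finset V)}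
    {ω : Finset (V × V)} (h : Disjoint ω P.cutArcs) {u v : V}
    (huv : component ω u = component ω v) : P.part u = P.part v := by
  have hmem : v ∈ component ω u := huv ▸ mem_component_self ω v
  have hgen := mem_component.1 hmem
  induction hgen with
  | rel a b hab =>
    by_contra hne
    exact disjoint_left.1 h hab (mem_cutArcs.2 hne)
  | refl => rfl
  | symm a b hab ih =>
    exact (ih (component_eq_of_mem (mem_component.2 hab)).symm (mem_component.2 hab)).symm
  | trans a b c hab hbc ih₁ ih₂ =>
    exact (ih₁ (component_eq_of_mem (mem_component.2 hab)).symm (mem_component.2 hab)).trans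
      (ih₂ (component_eq_of_mem (mem_component.2 hbc)).symm (mem_component.2 hbc))

/-- The `k`-cuts not containing any open arc. -/
def uncutPartitions (k : ℕ) (ω : Finset (V × V)) : Finset (Finpartition (univ : Finset V)) :=
  univ.filter fun P => P.parts.card = k ∧ Disjoint ω P.cutArcs

lemma card_uncutPartitions_le (k : ℕ) (ω : Finset (V × V)) :
    (uncutPartitions k ω).card ≤ k ^ (components ω).card := by
  classical
  have hmem : ∀ P : {P // P ∈ uncutPartitions k ω},
      P.1.parts.card = k ∧ Disjoint ω P.1.cutArcs := fun P => (mem_filter.1 P.2).2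
  choose φ hφ using fun P : {P // P ∈ uncutPartitions k ω} =>
    P.1.exists_colouring (hmem P).1
  choose rep hrep using fun S : {S // S ∈ components ω} => nonempty_of_mem_components S.2
  have hinj : Function.Injective fun P S => φ P (rep S) := by
    intro P Q hPQ
    refine Subtype.ext (Finpartition.ext_part fun u v => ?_)
    have hu : ∀ v, component ω v =
        component ω (rep ⟨component ω v, component_mem_components ω v⟩) := fun v =>
      (component_eq_of_mem (hrep ⟨component ω v, component_mem_components ω v⟩)).symm
    have hPu := fun v => Finpartition.part_eq_of_component_eq (hmem P).2 (hu v)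
    have hQu := fun v => Finpartition.part_eq_of_component_eq (hmem Q).2 (hu v)
    rw [hPu u, hPu v, hQu u, hQu v, ← hφ P, ← hφ Q]
    have h1 := fun S => congrFun hPQ S
    simp only at h1
    rw [h1, h1]
  have := Fintype.card_le_of_injective _ hinj
  rwa [Fintype.card_coe, Fintype.card_fun, Fintype.card_fin, Fintype.card_coe] at this

end Partitions

section Counting

variable {V : Type*} [Fintype V] [DecidableEq V] {w : V → V → ℝ} {k : ℕ} {L α : ℝ}

/-- The `k`-cuts of weight at most `α * L`. -/
noncomputable def approxMinCuts (w : V → V → ℝ) (k : ℕ) (L α : ℝ) :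
    Finset (Finpartition (univ : Finset V)) :=
  univ.filter fun P => P.parts.card = k ∧ kCutWeight w P ≤ α * L

lemma mem_approxMinCuts {P : Finpartition (univ : Finset V)} :
    P ∈ approxMinCuts w k L α ↔ P.parts.card = k ∧ kCutWeight w P ≤ α * L := by
  simp [approxMinCuts]

/-- A light `k`-cut survives, together with few components, with substantial probability. -/
lemma le_openMean_uncut [Nonempty V] (h : ColouringBound w k L) (hw : ∀ u v, 0 ≤ w u v)
    (hk : 2 ≤ k) (hL : 0 < L) (hα : 1 ≤ α) {P : Finpartition (univ : Finset V)}
    (hP : P ∈ approxMinCuts w k L α) :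
    1 / 2 * Real.exp (-(α * k * stopTime k (Fintype.card V))) ≤
      openMean (arcRate w k L) (stopTime k (Fintype.card V)) fun ω =>
        if Disjoint ω P.cutArcs then
          (if ((components ω).card : ℝ) ≤ 8 * α * k ^ 2 then 1 else 0) else 0 := by
  set w₁ : V → V → ℝ := fun u v => if P.part u = P.part v then w u v else 0 with hw₁
  set w₂ : V → V → ℝ := fun u v => if P.part u = P.part v then 0 else w u v with hw₂
  have hw₁0 : ∀ u v, 0 ≤ w₁ u v := fun u v => by
    simp only [hw₁]
    split_ifs
    exacts [hw u v, le_rfl]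
  have hw₂0 : ∀ u v, 0 ≤ w₂ u v := fun u v => by
    simp only [hw₂]
    split_ifs
    exacts [le_rfl, hw u v]
  have hadd : ∀ u v, w u v = w₁ u v + w₂ u v := fun u v => by
    simp only [hw₁, hw₂]
    split_ifs <;> simp
  have hsep : (sepWeight w₂ fun _ _ => True) = kCutWeight w P := by
    rw [kCutWeight_eq_sepWeight, sepWeight, sepWeight]
    congr 1
    refine sum_congr rfl fun u _ => sum_congr rfl fun v _ => ?_
    by_cases huv : P.part u = P.part v
    · simp [hw₂, huv]
    · simp [hw₂, huv]
  have hPL := (mem_approxMinCuts.1 hP).2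
  have hhalf := half_le_openMean_few h hk hL hw₁0 hw₂0 hadd hα (hsep.trans_le hPL)
  have hrate : (fun e => if e ∈ P.cutArcs then 0 else arcRate w k L e) = arcRate w₁ k L := by
    funext e
    by_cases he : P.part e.1 = P.part e.2
    · rw [if_neg (fun hmem => Finpartition.mem_cutArcs.1 hmem he)]
      simp [arcRate, hw₁, he]
    · rw [if_pos (Finpartition.mem_cutArcs.2 he)]
      simp [arcRate, hw₁, he]
  have hsum : ∑ e ∈ P.cutArcs, arcRate w k L e = k / L * kCutWeight w P := by
    classical
    rw [kCutWeight_eq_sepWeight, ← sum_arcRate, Finpartition.cutArcs, sum_filter]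
    congr! 2
  rw [openMean_disjoint, hrate, hsum, mul_comm (1 / 2)]
  refine mul_le_mul ?_ hhalf (by norm_num) (Real.exp_pos _).le
  rw [Real.exp_le_exp, neg_le_neg_iff]
  refine mul_le_mul_of_nonneg_right ?_ (stopTime_nonneg Fintype.card_pos)
  calc k / L * kCutWeight w P ≤ k / L * (α * L) := mul_le_mul_of_nonneg_left hPL (by positivity)
    _ = α * k := by field_simp

lemma card_approxMinCuts_le [Nonempty V] (h : ColouringBound w k L) (hw : ∀ u v, 0 ≤ w u v)
    (hk : 2 ≤ k) (hL : 0 < L) (hα : 1 ≤ α) :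
    ((approxMinCuts w k L α).card : ℝ) ≤ 2 * (k : ℝ) ^ (8 * α * (k : ℝ) ^ 2) *
      ((Fintype.card V : ℝ) * (1 + 2 * k * lightCoeff k)) ^ (α * k) := by
  set T := stopTime k (Fintype.card V) with hT
  have hT0 : 0 ≤ T := stopTime_nonneg Fintype.card_pos
  have hk1 : (1 : ℝ) ≤ k := by
    have : 1 ≤ k := by omega
    exact_mod_cast this
  have h1 := sum_le_sum fun P hP => le_openMean_uncut h hw hk hL hα (P := P) hP
  rw [sum_const, nsmul_eq_mul, ← openMean_sum] at h1
  have h2 := h1.trans (openMean_mono (arcRate_nonneg hw hL) hT0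
    (g := fun _ => (k : ℝ) ^ (8 * α * (k : ℝ) ^ 2)) fun ω => by
      split_ifs with hω
      · rw [sum_boole]
        have hsub : ((approxMinCuts w k L α).filter fun P => Disjoint ω P.cutArcs) ⊆
            uncutPartitions k ω := fun P hP => by
          rw [mem_filter, mem_approxMinCuts] at hP
          exact mem_filter.2 ⟨mem_univ _, hP.1.1, hP.2⟩
        calc _ ≤ (((k ^ (components ω).card : ℕ)) : ℝ) :=
              Nat.cast_le.2 ((card_le_card hsub).trans (card_uncutPartitions_le k ω))
          _ = (k : ℝ) ^ ((components ω).card : ℝ) := by rw [Real.rpow_natCast, Nat.cast_pow]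
          _ ≤ _ := Real.rpow_le_rpow_of_exponent_le hk1 hω
      · simp only [ite_self, sum_const_zero]
        positivity)
  rw [openMean_const] at h2
  have hn : (0 : ℝ) < Fintype.card V := by exact_mod_cast Fintype.card_pos
  have hpos : (0 : ℝ) < Fintype.card V * (1 + 2 * k * lightCoeff k) := by positivity
  have hexp : Real.exp (α * k * T) =
      ((Fintype.card V : ℝ) * (1 + 2 * k * lightCoeff k)) ^ (α * k) := by
    rw [Real.rpow_def_of_pos hpos, hT, stopTime, mul_comm]
  rw [← hexp]
  have h3 := mul_le_mul_of_nonneg_right h2 (Real.exp_pos (α * k * T)).le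
  rw [Real.exp_neg] at h3
  have h4 : ((approxMinCuts w k L α).card : ℝ) * (1 / 2 * (Real.exp (α * k * T))⁻¹) *
      Real.exp (α * k * T) = (approxMinCuts w k L α).card / 2 := by
    have := (Real.exp_pos (α * k * T)).ne'
    field_simp
  rw [h4] at h3
  linarith

end Counting

section Constants

lemma lightCoeff_factor_le {k : ℕ} (hk : 3 ≤ k) : 1 + 2 * k * lightCoeff k ≤ k ^ (20 * k) := by
  have h3 : 3 ≤ k := hk
  have hb1 : k * (3 * k) + 1 ≤ k ^ 4 := by nlinarith [Nat.pow_le_pow_left h3 2]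
  have hb2 : 2 * k ^ 2 * (3 * k) + 1 ≤ k ^ 5 := by
    have h2 := Nat.pow_le_pow_left h3 2
    have h33 := Nat.pow_le_pow_left h3 3
    nlinarith
  have e1 : (k * (3 * k) + 1) ^ (3 * k) ≤ k ^ (15 * k) := by
    calc _ ≤ (k ^ 5) ^ (3 * k) :=
          Nat.pow_le_pow_left (hb1.trans (Nat.pow_le_pow_right (by omega) (by norm_num))) _
      _ = _ := by rw [← pow_mul]; congr 1; ring
  have e2 : (2 * k ^ 2 * (3 * k) + 1) ^ (3 * k) ≤ k ^ (15 * k) := by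
    calc _ ≤ (k ^ 5) ^ (3 * k) := Nat.pow_le_pow_left hb2 _
      _ = _ := by rw [← pow_mul]; congr 1; ring
  have hone : 1 ≤ k ^ (15 * k) := Nat.one_le_pow _ _ (by omega)
  have hk5 : 1 + 2 * k * (2 * (1 + 3 * k)) ≤ k ^ 5 := by
    have h2 := Nat.pow_le_pow_left h3 2
    have h33 := Nat.pow_le_pow_left h3 3
    nlinarith
  calc 1 + 2 * k * lightCoeff k
      ≤ k ^ (15 * k) + 2 * k * (2 * (k ^ (15 * k) + 3 * k * k ^ (15 * k))) := by
        rw [lightCoeff]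
        gcongr
    _ = (1 + 2 * k * (2 * (1 + 3 * k))) * k ^ (15 * k) := by ring
    _ ≤ k ^ 5 * k ^ (15 * k) := Nat.mul_le_mul_right _ hk5
    _ = k ^ (5 + 15 * k) := (pow_add _ _ _).symm
    _ ≤ k ^ (20 * k) := Nat.pow_le_pow_right (by omega) (by omega)

lemma counting_bound_le {k n : ℕ} {α : ℝ} (hk : 3 ≤ k) (hα : 1 ≤ α) :
    2 * (k : ℝ) ^ (8 * α * (k : ℝ) ^ 2) *
      ((n : ℝ) * (1 + 2 * k * lightCoeff k)) ^ (α * k) ≤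
    (n : ℝ) ^ (α * k) * (k : ℝ) ^ (29 * α * (k : ℝ) ^ 2) := by
  have hk3 : (3 : ℝ) ≤ k := by exact_mod_cast hk
  have hk0 : (0 : ℝ) < k := by linarith
  have hαk : 0 ≤ α * k := by positivity
  have h1 : (1 + 2 * k * lightCoeff k : ℝ) ^ (α * k) ≤ (k : ℝ) ^ (20 * α * (k : ℝ) ^ 2) := by
    calc _ ≤ ((k : ℝ) ^ (20 * k)) ^ (α * k) := by
          refine Real.rpow_le_rpow (by positivity) ?_ hαk
          exact_mod_cast lightCoeff_factor_le hk
      _ = _ := by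
          rw [← Real.rpow_natCast, ← Real.rpow_mul hk0.le]
          congr 1
          push_cast
          ring
  have h2 : (2 : ℝ) ≤ (k : ℝ) ^ (α * (k : ℝ) ^ 2) := by
    calc (2 : ℝ) ≤ k := by linarith
      _ = (k : ℝ) ^ (1 : ℝ) := (Real.rpow_one _).symm
      _ ≤ _ := Real.rpow_le_rpow_of_exponent_le (by linarith) (by nlinarith)
  rw [Real.mul_rpow (by positivity) (by positivity)]
  have h3 : (k : ℝ) ^ (29 * α * (k : ℝ) ^ 2) = (k : ℝ) ^ (α * (k : ℝ) ^ 2) *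
      (k : ℝ) ^ (8 * α * (k : ℝ) ^ 2) * (k : ℝ) ^ (20 * α * (k : ℝ) ^ 2) := by
    rw [← Real.rpow_add hk0, ← Real.rpow_add hk0]
    congr 1
    ring
  rw [h3]
  calc _ = (n : ℝ) ^ (α * k) * (2 * (k : ℝ) ^ (8 * α * (k : ℝ) ^ 2) *
        (1 + 2 * k * lightCoeff k : ℝ) ^ (α * k)) := by ring
    _ ≤ _ := by gcongr

end Constants

/-- There is an absolute constant `C > 0` such that for every integer `k ≥ 3`, every real
`α ≥ 1`, and every weighted multigraph on a vertex set `V` with `|V| = n ≥ k` and `λ_k > 0`,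
the number of `k`-cuts of weight at most `α·λ_k` is at most `n^(α·k) * k^(C·α·k²)`. -/
theorem number_of_approximate_min_k_cuts :
    ∃ C : ℝ, 0 < C ∧
      ∀ (k : ℕ) (α : ℝ) (V : Type) [Fintype V] [DecidableEq V] (w : V → V → ℝ) (lam : ℝ),
        3 ≤ k →
        1 ≤ α →
        k ≤ Fintype.card V →
        (∀ u v, w u v = w v u) →
        (∀ u v, 0 ≤ w u v) →
        (∀ v, w v v = 0) →
        (∃ P : Finpartition (univ : Finset V), P.parts.card = k ∧ kCutWeight w P = lam) →
        (∀ P : Finpartition (univ : Finset V), P.parts.card = k → lam ≤ kCutWeight w P) →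
        0 < lam →
        ({P : Finpartition (univ : Finset V) |
            P.parts.card = k ∧ kCutWeight w P ≤ α * lam}.ncard : ℝ) ≤
          (Fintype.card V : ℝ) ^ (α * k) * (k : ℝ) ^ (C * α * (k : ℝ) ^ 2) := by
  refine ⟨29, by norm_num, fun k α V _ _ w lam hk hα hn _ hw _ _ hmin hlam => ?_⟩
  have : Nonempty V := Fintype.card_pos_iff.1 (by omega)
  have hset : {P : Finpartition (univ : Finset V) |
      P.parts.card = k ∧ kCutWeight w P ≤ α * lam} = approxMinCuts w k lam α := by
    ext P
    rw [mem_coe, mem_approxMinCuts, Set.mem_ofPred_eq]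
  rw [hset, Set.ncard_coe_finset]
  exact (card_approxMinCuts_le (colouringBound_of_le_kCutWeight hw (by omega) hmin) hw
    (by omega) hlam hα).trans (counting_bound_le hk hα)
end

section
/- There is an absolute constant C > 0 such that for every integer k ≥ 3 and every weighted multigraph on a vertex set V with |V| = n ≥ k, the number of medium cuts is at most k^{C·k} · n. -/
open Finset

/-- The weight `∂S` of the 2-cut with shore `S`: the total weight of edges crossing
from `S` to its complement. -/
noncomputable def cutW {V : Type*} [Fintype V] [DecidableEq V] (w : V → V → ℝ)
    (S : Finset V) : ℝ :=
  ∑ u ∈ S, ∑ v ∈ Sᶜ, w u v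

/-- The total weight of the ordered pairs in `A × B`. -/
noncomputable def crossWeight {V : Type*} (w : V → V → ℝ) (A B : Finset V) : ℝ :=
  ∑ u ∈ A, ∑ v ∈ B, w u v

section CrossWeight

variable {V : Type*} {w : V → V → ℝ}

theorem crossWeight_comm (hs : ∀ u v, w u v = w v u) (A B : Finset V) :
    crossWeight w A B = crossWeight w B A := by
  unfold crossWeight
  rw [Finset.sum_comm]
  simp only [hs]

theorem crossWeight_nonneg (hn : ∀ u v, 0 ≤ w u v) (A B : Finset V) : 0 ≤ crossWeight w A B :=
  Finset.sum_nonneg fun _ _ => Finset.sum_nonneg fun _ _ => hn _ _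

theorem crossWeight_mono (hn : ∀ u v, 0 ≤ w u v) {A A' B B' : Finset V} (hA : A ⊆ A')
    (hB : B ⊆ B') : crossWeight w A B ≤ crossWeight w A' B' :=
  (Finset.sum_le_sum fun _ _ => Finset.sum_le_sum_of_subset_of_nonneg hB fun _ _ _ => hn _ _).trans
    (Finset.sum_le_sum_of_subset_of_nonneg hA fun _ _ _ => Finset.sum_nonneg fun _ _ => hn _ _)

variable [DecidableEq V]

theorem crossWeight_union_left {A A' : Finset V} (h : Disjoint A A') (B : Finset V) :
    crossWeight w (A ∪ A') B = crossWeight w A B + crossWeight w A' B :=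
  Finset.sum_union h

theorem crossWeight_union_right (A : Finset V) {B B' : Finset V} (h : Disjoint B B') :
    crossWeight w A (B ∪ B') = crossWeight w A B + crossWeight w A B' := by
  simp only [crossWeight, Finset.sum_union h, Finset.sum_add_distrib]

variable [Fintype V]

theorem cutW_eq_crossWeight (S : Finset V) : cutW w S = crossWeight w S Sᶜ := rfl

theorem cutW_compl (hs : ∀ u v, w u v = w v u) (S : Finset V) : cutW w Sᶜ = cutW w S := by
  rw [cutW_eq_crossWeight, cutW_eq_crossWeight, compl_compl, crossWeight_comm hs]

/-- Posimodularity of the cut weight, with its error term. -/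
theorem cutW_add_cutW_eq (hs : ∀ u v, w u v = w v u) (X Y : Finset V) :
    cutW w X + cutW w Y =
      cutW w (X \ Y) + cutW w (Y \ X) + 2 * crossWeight w (X ∩ Y) (X ∪ Y)ᶜ := by
  have e1 : X = (X \ Y) ∪ (X ∩ Y) := by ext; simp; tauto
  have e2 : Y = (Y \ X) ∪ (X ∩ Y) := by ext; simp; tauto
  have c1 : Xᶜ = (Y \ X) ∪ (X ∪ Y)ᶜ := by ext; simp; tauto
  have c2 : Yᶜ = (X \ Y) ∪ (X ∪ Y)ᶜ := by ext; simp; tauto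
  have c3 : (X \ Y)ᶜ = (Y \ X) ∪ ((X ∩ Y) ∪ (X ∪ Y)ᶜ) := by ext; simp; tauto
  have c4 : (Y \ X)ᶜ = (X \ Y) ∪ ((X ∩ Y) ∪ (X ∪ Y)ᶜ) := by ext; simp; tauto
  have d1 : Disjoint (X \ Y) (X ∩ Y) := by rw [Finset.disjoint_left]; simp; tauto
  have d2 : Disjoint (Y \ X) (X ∩ Y) := by rw [Finset.disjoint_left]; simp; tauto
  have d3 : Disjoint (Y \ X) (X ∪ Y)ᶜ := by rw [Finset.disjoint_left]; simp; tauto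
  have d4 : Disjoint (X \ Y) (X ∪ Y)ᶜ := by rw [Finset.disjoint_left]; simp; tauto
  have d5 : Disjoint (X ∩ Y) (X ∪ Y)ᶜ := by rw [Finset.disjoint_left]; simp; tauto
  have d6 : Disjoint (Y \ X) ((X ∩ Y) ∪ (X ∪ Y)ᶜ) := Finset.disjoint_union_right.2 ⟨d2, d3⟩
  have d7 : Disjoint (X \ Y) ((X ∩ Y) ∪ (X ∪ Y)ᶜ) := Finset.disjoint_union_right.2 ⟨d1, d4⟩
  have hX : cutW w X = crossWeight w ((X \ Y) ∪ (X ∩ Y)) ((Y \ X) ∪ (X ∪ Y)ᶜ) := by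
    rw [← e1, ← c1]; rfl
  have hY : cutW w Y = crossWeight w ((Y \ X) ∪ (X ∩ Y)) ((X \ Y) ∪ (X ∪ Y)ᶜ) := by
    rw [← e2, ← c2]; rfl
  rw [hX, hY, cutW_eq_crossWeight (X \ Y), cutW_eq_crossWeight (Y \ X), c3, c4,
    crossWeight_union_left d1, crossWeight_union_left d2, crossWeight_union_right _ d3,
    crossWeight_union_right _ d3, crossWeight_union_right _ d4, crossWeight_union_right _ d4,
    crossWeight_union_right _ d6, crossWeight_union_right _ d7, crossWeight_union_right _ d5,
    crossWeight_union_right _ d5, crossWeight_comm hs (X ∩ Y) (X \ Y),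
    crossWeight_comm hs (X ∩ Y) (Y \ X)]
  ring

end CrossWeight

/-- A colouring respects a set if the set is a union of colour classes. -/
def Respects {V : Type*} (f : V → ℕ) (X : Finset V) : Prop :=
  ∀ u v, f u = f v → u ∈ X → v ∈ X

theorem Respects.compl {V : Type*} [Fintype V] [DecidableEq V] {f : V → ℕ} {X : Finset V}
    (h : Respects f X) : Respects f Xᶜ := by
  intro u v huv hu
  rw [Finset.mem_compl] at hu ⊢
  exact fun hv => hu (h v u huv.symm hv)

open Classical in
theorem card_respects_le {V : Type*} [Fintype V] {f : V → ℕ} {k : ℕ} (hf : ∀ v, f v < k) :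
    #{X : Finset V | Respects f X} ≤ 2 ^ k := by
  rw [← Finset.card_range k, ← Finset.card_powerset]
  refine Finset.card_le_card_of_injOn (fun X => X.image f) ?_ ?_
  · intro X _
    simp only [Finset.coe_powerset, Set.mem_preimage, Set.mem_powerset_iff, Finset.coe_subset]
    exact Finset.image_subset_iff.2 fun v _ => Finset.mem_range.2 (hf v)
  · have key : ∀ X Y : Finset V, Respects f Y → X.image f = Y.image f → X ⊆ Y := by
      intro X Y hY h v hv
      obtain ⟨y, hy, hyv⟩ := Finset.mem_image.1 (h ▸ Finset.mem_image_of_mem f hv)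
      exact hY y v hyv hy
    intro X hX Y hY h
    simp only [Finset.coe_filter, Finset.mem_univ, true_and, Set.mem_ofPred_eq] at hX hY
    exact (key X Y hY h).antisymm (key Y X hX h.symm)

section Colouring

variable {V : Type*} [Fintype V] [DecidableEq V] {w : V → V → ℝ}

/-- The weight of the partition of the vertex set into the colour classes of `f`. -/
noncomputable def colourWeight (w : V → V → ℝ) (f : V → ℕ) : ℝ :=
  (1 / 2) * ∑ u, ∑ v, if f u = f v then 0 else w u v

theorem exists_finpartition_of_colouring (f : V → ℕ) :
    ∃ P : Finpartition (univ : Finset V), P.parts.card = (univ.image f).card ∧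
      kCutWeight w P = colourWeight w f := by
  classical
  refine ⟨Finpartition.ofSetoid (Setoid.ker f), ?_, ?_⟩
  · have h : (Finpartition.ofSetoid (Setoid.ker f)).parts =
        (univ.image f).image fun i => ({v | i = f v} : Finset V) := by
      rw [Finset.image_image, Finpartition.ofSetoid, Finpartition.ofSetSetoid_parts]
      refine Finset.image_congr fun v _ => Finset.ext fun u => ?_
      simp only [Function.comp_apply, Finset.mem_filter]
      rfl
    rw [h, Finset.card_image_of_injOn]
    intro i hi j _ hij
    obtain ⟨v, -, rfl⟩ := Finset.mem_image.1 (Finset.mem_coe.1 hi)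
    have : v ∈ ({x | j = f x} : Finset V) := by
      dsimp only at hij
      rw [← hij]
      simp
    simpa using (Finset.mem_filter.1 this).2.symm
  · have h : ∀ u v, (∃ p ∈ (Finpartition.ofSetoid (Setoid.ker f)).parts, u ∈ p ∧ v ∈ p) ↔
        f u = f v := by
      intro u v
      rw [← Finpartition.mem_part_iff_exists, Finpartition.mem_part_ofSetoid_iff_rel,
        ← Setoid.ker_def (f := f)]
      exact eq_comm
    simp only [kCutWeight, colourWeight, h]

/-- Splitting a colour class by a set `Z`, giving the part inside `Z` a new colour `m`. -/
theorem exists_split_colouring_s2 (hs : ∀ u v, w u v = w v u) (hn : ∀ u v, 0 ≤ w u v)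
    {f : V → ℕ} {m : ℕ} (hf : univ.image f = range m) {i : ℕ} {Z : Finset V} {a b : V}
    (ha : f a = i) (hb : f b = i) (haZ : a ∈ Z) (hbZ : b ∉ Z) :
    ∃ g : V → ℕ, univ.image g = range (m + 1) ∧
      colourWeight w g ≤ colourWeight w f +
        crossWeight w {v ∈ Z | f v = i} {v ∈ Zᶜ | f v = i} ∧
      (∀ u v, g u = g v → f u = f v) ∧
      (∀ u v, g u = g v → f u = i → u ∈ Z → v ∈ Z) := by
  have hlt : ∀ v, f v < m := fun v => by
    rw [← Finset.mem_range, ← hf]; exact Finset.mem_image_of_mem f (Finset.mem_univ v)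
  refine ⟨fun v => if f v = i ∧ v ∈ Z then m else f v, ?_, ?_, ?_, ?_⟩
  · ext j
    simp only [Finset.mem_image, Finset.mem_univ, true_and, Finset.mem_range]
    constructor
    · rintro ⟨v, rfl⟩
      have := hlt v
      split_ifs <;> omega
    · intro hj
      rcases Nat.lt_succ_iff_lt_or_eq.1 hj with hj | rfl
      · have : j ∈ univ.image f := hf ▸ Finset.mem_range.2 hj
        obtain ⟨v, -, rfl⟩ := Finset.mem_image.1 this
        by_cases hv : f v = i
        · exact ⟨b, by simp [hbZ, hb, hv]⟩
        · exact ⟨v, by simp [hv]⟩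
      · exact ⟨a, by simp [ha, haZ]⟩
  · have hsum : ∀ A B : Finset V, crossWeight w A B =
        ∑ u, ∑ v, if u ∈ A ∧ v ∈ B then w u v else 0 := by
      intro A B
      simp [crossWeight, ite_and, Finset.sum_ite_mem]
    have hc := crossWeight_comm hs {v ∈ Z | f v = i} {v ∈ Zᶜ | f v = i}
    have h2 : crossWeight w {v ∈ Z | f v = i} {v ∈ Zᶜ | f v = i} =
        (1 / 2) * (crossWeight w {v ∈ Z | f v = i} {v ∈ Zᶜ | f v = i} +
          crossWeight w {v ∈ Zᶜ | f v = i} {v ∈ Z | f v = i}) := by linarith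
    rw [h2, colourWeight, colourWeight, ← mul_add, hsum, hsum, ← Finset.sum_add_distrib,
      ← Finset.sum_add_distrib]
    refine mul_le_mul_of_nonneg_left (Finset.sum_le_sum fun u _ => ?_) (by norm_num)
    rw [← Finset.sum_add_distrib, ← Finset.sum_add_distrib]
    refine Finset.sum_le_sum fun v _ => ?_
    have h0 := hn u v
    have hu := hlt u
    have hv := hlt v
    simp only [Finset.mem_filter, Finset.mem_compl]
    by_cases h1 : f u = i <;> by_cases h2 : f v = i <;> by_cases h3 : u ∈ Z <;>
      by_cases h4 : v ∈ Z <;> simp [h1, h2, h3, h4] <;> split_ifs <;> first | linarith | omega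
  · intro u v
    have hu := hlt u
    have hv := hlt v
    dsimp only
    split_ifs <;> intros <;> omega
  · intro u v h hu huZ
    by_contra hvZ
    have hv := hlt v
    simp only [hu, huZ, hvZ, and_self, and_false, if_true, if_false] at h
    omega

/-- If every `k`-cut has weight at least `k * c`, a cut of weight less than `2 * c` extends to a
colouring with fewer than `k` colours, no class of which can be split at cost less than `c`. -/
theorem exists_unsplittable_colouring (hs : ∀ u v, w u v = w v u) (hn : ∀ u v, 0 ≤ w u v)
    {k : ℕ} {c : ℝ} (hk : 3 ≤ k)
    (hmin : ∀ P : Finpartition (univ : Finset V), P.parts.card = k → k * c ≤ kCutWeight w P)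
    {X : Finset V} (hX : X.Nonempty) (hX' : Xᶜ.Nonempty) (hXc : cutW w X < 2 * c) :
    ∃ f : V → ℕ, (∀ v, f v < k) ∧ Respects f X ∧
      ∀ (Z : Finset V) (a b : V), f a = f b → a ∈ Z → b ∉ Z →
        c ≤ crossWeight w {v ∈ Z | f v = f a} {v ∈ Zᶜ | f v = f a} := by
  classical
  let good : ℕ → Prop := fun m =>
    ∃ f : V → ℕ, univ.image f = range m ∧ colourWeight w f < m * c ∧ Respects f X
  have h2 : good 2 := by
    obtain ⟨a, ha⟩ := hX
    obtain ⟨b, hb⟩ := hX'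
    have hf : univ.image (fun _ : V => 0) = range 1 := by
      ext j
      simp only [Finset.mem_image, Finset.mem_univ, true_and, Finset.mem_range]
      exact ⟨by rintro ⟨_, rfl⟩; omega, fun h => ⟨a, by omega⟩⟩
    obtain ⟨g, hg, hgw, -, hgX⟩ := exists_split_colouring_s2 hs hn hf (i := 0) (a := a) (b := b)
      rfl rfl ha (Finset.mem_compl.1 hb)
    refine ⟨g, hg, ?_, fun u v h => hgX u v h rfl⟩
    have h0 : colourWeight w (fun _ : V => 0) = 0 := by simp [colourWeight]
    simp only [h0, zero_add, Finset.filter_true] at hgw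
    push_cast
    exact hgw.trans_lt hXc
  have hnot : ¬ good k := by
    rintro ⟨f, hf, hfw, -⟩
    obtain ⟨P, hP, hPw⟩ := exists_finpartition_of_colouring (w := w) f
    rw [hf, Finset.card_range] at hP
    have := hmin P hP
    linarith
  have hm := Nat.findGreatest_spec (P := good) (by omega : 2 ≤ k) h2
  set m := Nat.findGreatest good k with hmdef
  have hmk : m < k := (Nat.findGreatest_le k).lt_of_ne fun h => hnot (h ▸ hm)
  obtain ⟨f, hf, hfw, hfX⟩ := hm
  refine ⟨f, fun v => ?_, hfX, fun Z a b hab haZ hbZ => ?_⟩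
  · have : f v ∈ range m := hf ▸ Finset.mem_image_of_mem f (Finset.mem_univ v)
    exact (Finset.mem_range.1 this).trans hmk
  · by_contra! hlt
    obtain ⟨g, hg, hgw, hgf, -⟩ := exists_split_colouring_s2 hs hn hf rfl hab.symm haZ hbZ
    refine Nat.findGreatest_is_greatest (P := good) (n := k) (k := m + 1) (by omega) (by omega)
      ⟨g, hg, ?_, fun u v h => hfX u v (hgf u v h)⟩
    push_cast
    linarith

end Colouring

section SetFamilies

variable {V : Type*} [DecidableEq V]

theorem card_le_of_laminar (S : Finset V) (L : Finset (Finset V))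
    (hsub : ∀ A ∈ L, A ⊆ S ∧ A.Nonempty)
    (hlam : ∀ A ∈ L, ∀ B ∈ L, A ⊆ B ∨ B ⊆ A ∨ Disjoint A B) : L.card ≤ 2 * S.card := by
  induction S using Finset.induction_on generalizing L with
  | empty =>
    have : L = ∅ := Finset.eq_empty_of_forall_notMem fun A hA =>
      (hsub A hA).2.ne_empty (Finset.subset_empty.1 (hsub A hA).1)
    simp [this]
  | insert x S hx ih =>
    let L₀ := {A ∈ L | x ∉ A}
    let L₁ := {A ∈ L | x ∈ A ∧ A ≠ {x}}
    let E := L₁.image fun A => A.erase x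
    have hE : E.card = L₁.card := by
      refine Finset.card_image_of_injOn fun A hA B hB h => ?_
      have hA' := (Finset.mem_filter.1 (Finset.mem_coe.1 hA)).2.1
      have hB' := (Finset.mem_filter.1 (Finset.mem_coe.1 hB)).2.1
      rw [← Finset.insert_erase hA', ← Finset.insert_erase hB', h]
    have hL : L ⊆ insert {x} (L₀ ∪ L₁) := by
      intro A hA
      simp only [L₀, L₁, Finset.mem_insert, Finset.mem_union, Finset.mem_filter]
      tauto
    have hcard : L.card ≤ L₀.card + L₁.card + 1 :=
      ((Finset.card_le_card hL).trans (Finset.card_insert_le _ _)).trans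
        (Nat.add_le_add_right (Finset.card_union_le _ _) 1)
    have hinter : (L₀ ∩ E).card ≤ 1 := by
      have key : ∀ A ∈ L₀, ∀ B ∈ L₁, A.Nonempty → A ⊆ B.erase x →
          ∀ A' ∈ L₁, A'.erase x = A → B.erase x ∈ L → B.erase x ⊆ A := by
        intro A hA B _ hAne hAB A' hA' hA'A hBL
        obtain ⟨y, hy⟩ := hAne
        have hxA' := (Finset.mem_filter.1 hA').2.1
        rcases hlam A' (Finset.mem_filter.1 hA').1 _ hBL with h | h | h
        · exact absurd (h hxA') (Finset.notMem_erase x B)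
        · intro z hz
          rw [← hA'A]
          exact Finset.mem_erase.2 ⟨(Finset.mem_erase.1 hz).1, h hz⟩
        · refine absurd (hAB hy) (Finset.disjoint_left.1 h ?_)
          rw [← hA'A] at hy
          exact Finset.mem_of_mem_erase hy
      refine Finset.card_le_one.2 fun A hA B hB => ?_
      obtain ⟨hA₀, hAE⟩ := Finset.mem_inter.1 hA
      obtain ⟨hB₀, hBE⟩ := Finset.mem_inter.1 hB
      obtain ⟨A', hA', rfl⟩ := Finset.mem_image.1 hAE
      obtain ⟨B', hB', rfl⟩ := Finset.mem_image.1 hBE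
      have hAL := (Finset.mem_filter.1 hA₀).1
      have hBL := (Finset.mem_filter.1 hB₀).1
      rcases hlam _ hAL _ hBL with h | h | h
      · exact h.antisymm (key _ hA₀ B' hB' (hsub _ hAL).2 h A' hA' rfl hBL)
      · exact (key _ hB₀ A' hA' (hsub _ hBL).2 h B' hB' rfl hAL).antisymm h
      · exfalso
        have hxA' := (Finset.mem_filter.1 hA').2.1
        have hxB' := (Finset.mem_filter.1 hB').2.1
        obtain ⟨y, hy⟩ := (hsub _ hAL).2
        obtain ⟨z, hz⟩ := (hsub _ hBL).2
        rcases hlam _ (Finset.mem_filter.1 hA').1 _ (Finset.mem_filter.1 hB').1 with h' | h' | h'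
        · exact Finset.disjoint_left.1 h hy (Finset.erase_subset_erase x h' hy)
        · exact Finset.disjoint_left.1 h (Finset.erase_subset_erase x h' hz) hz
        · exact Finset.disjoint_left.1 h' hxA' hxB'
    have hmem : ∀ A ∈ L₀ ∪ E, ∃ B ∈ L, A = B.erase x ∧ A.Nonempty := by
      intro A hA
      rcases Finset.mem_union.1 hA with hA | hA
      · obtain ⟨hA, hxA⟩ := Finset.mem_filter.1 hA
        exact ⟨A, hA, (Finset.erase_eq_of_notMem hxA).symm, (hsub A hA).2⟩
      · obtain ⟨B, hB, rfl⟩ := Finset.mem_image.1 hA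
        obtain ⟨hB, hxB, hne⟩ := Finset.mem_filter.1 hB
        refine ⟨B, hB, rfl, Finset.nonempty_iff_ne_empty.2 fun h => ?_⟩
        rcases (Finset.erase_eq_empty_iff B x).1 h with h | h
        · simp [h] at hxB
        · exact hne h
    have hrec := ih (L₀ ∪ E)
      (fun A hA => by
        obtain ⟨B, hB, rfl, hne⟩ := hmem A hA
        exact ⟨Finset.subset_insert_iff.1 (hsub B hB).1, hne⟩)
      (fun A hA A' hA' => by
        obtain ⟨B, hB, rfl, -⟩ := hmem A hA
        obtain ⟨B', hB', rfl, -⟩ := hmem A' hA'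
        rcases hlam B hB B' hB' with h | h | h
        · exact Or.inl (Finset.erase_subset_erase x h)
        · exact Or.inr (Or.inl (Finset.erase_subset_erase x h))
        · exact Or.inr (Or.inr (h.mono (Finset.erase_subset _ _) (Finset.erase_subset _ _))))
    have := Finset.card_union_add_card_inter L₀ E
    rw [Finset.card_insert_of_notMem hx]
    omega

/-- Two sets cross if all four of their quadrants are nonempty. -/
def Crossing [Fintype V] (X Y : Finset V) : Prop :=
  (X ∩ Y).Nonempty ∧ (X \ Y).Nonempty ∧ (Y \ X).Nonempty ∧ (X ∪ Y)ᶜ.Nonempty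

theorem Crossing.symm [Fintype V] {X Y : Finset V} (h : Crossing X Y) : Crossing Y X :=
  ⟨Finset.inter_comm X Y ▸ h.1, h.2.2.1, h.2.1, Finset.union_comm X Y ▸ h.2.2.2⟩

theorem Crossing.compl_right [Fintype V] {X Y : Finset V} (h : Crossing X Y) : Crossing X Yᶜ := by
  obtain ⟨h1, h2, h3, h4⟩ := h
  refine ⟨h2.mono ?_, h1.mono ?_, h4.mono ?_, h3.mono ?_⟩ <;> intro v <;> simp <;> tauto

theorem Crossing.compl_left [Fintype V] {X Y : Finset V} (h : Crossing X Y) : Crossing Xᶜ Y :=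
  h.symm.compl_right.symm

theorem card_le_of_pairwise_not_crossing [Fintype V] (L : Finset (Finset V))
    (hne : ∀ A ∈ L, A.Nonempty ∧ Aᶜ.Nonempty)
    (hcross : ∀ A ∈ L, ∀ B ∈ L, ¬ Crossing A B) : L.card ≤ 4 * Fintype.card V := by
  rcases isEmpty_or_nonempty V with hV | ⟨⟨x⟩⟩
  · have : L = ∅ := Finset.eq_empty_of_forall_notMem fun A hA => by
      obtain ⟨v, -⟩ := (hne A hA).1
      exact hV.elim v
    simp [this]
  have key : ∀ L' : Finset (Finset V), (∀ A ∈ L', A.Nonempty ∧ x ∉ A) →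
      (∀ A ∈ L', ∀ B ∈ L', ¬ Crossing A B) → L'.card ≤ 2 * Fintype.card V := by
    intro L' h1 h2
    refine card_le_of_laminar univ L' (fun A hA => ⟨Finset.subset_univ A, (h1 A hA).1⟩) ?_
    intro A hA B hB
    by_contra! h
    obtain ⟨hAB, hBA, hd⟩ := h
    refine h2 A hA B hB ⟨Finset.not_disjoint_iff_nonempty_inter.1 hd,
      Finset.sdiff_nonempty.2 hAB, Finset.sdiff_nonempty.2 hBA, x, ?_⟩
    simp [(h1 A hA).2, (h1 B hB).2]
  have h0 := key {A ∈ L | x ∉ A}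
    (fun A hA => ⟨(hne A (Finset.mem_filter.1 hA).1).1, (Finset.mem_filter.1 hA).2⟩)
    (fun A hA B hB => hcross A (Finset.mem_filter.1 hA).1 B (Finset.mem_filter.1 hB).1)
  have h1 := key ({A ∈ L | x ∈ A}.image compl)
    (fun A hA => by
      obtain ⟨B, hB, rfl⟩ := Finset.mem_image.1 hA
      exact ⟨(hne B (Finset.mem_filter.1 hB).1).2, by simpa using (Finset.mem_filter.1 hB).2⟩)
    (fun A hA B hB hAB => by
      obtain ⟨A', hA', rfl⟩ := Finset.mem_image.1 hA
      obtain ⟨B', hB', rfl⟩ := Finset.mem_image.1 hB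
      have := hAB.compl_left.compl_right
      rw [compl_compl, compl_compl] at this
      exact hcross A' (Finset.mem_filter.1 hA').1 B' (Finset.mem_filter.1 hB').1 this)
  rw [Finset.card_image_of_injective _ compl_injective] at h1
  have := Finset.card_filter_add_card_filter_not (s := L) (fun A => x ∈ A)
  omega

end SetFamilies

open Classical in
/-- A relation with out-degrees at most `d` whose independent sets have at most `M` elements lives
on at most `(2 * d + 1) * M` elements. -/
theorem card_le_of_outdegree_le {α : Type*} (R : α → α → Prop) (d M : ℕ) (A : Finset α)
    (hd : ∀ a ∈ A, #{b ∈ A | R a b} ≤ d)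
    (hM : ∀ I ⊆ A, (∀ a ∈ I, ∀ b ∈ I, a ≠ b → ¬ R a b) → I.card ≤ M) :
    A.card ≤ (2 * d + 1) * M := by
  suffices h : ∃ I ⊆ A, (∀ a ∈ I, ∀ b ∈ I, a ≠ b → ¬ R a b) ∧
      A.card ≤ (2 * d + 1) * I.card by
    obtain ⟨I, hI, hR, hc⟩ := h
    exact hc.trans (Nat.mul_le_mul_left _ (hM I hI hR))
  clear hM
  induction A using Finset.strongInduction with
  | H A ih =>
    rcases A.eq_empty_or_nonempty with rfl | hA
    · exact ⟨∅, subset_rfl, by simp, by simp⟩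
    obtain ⟨x, hx, hin⟩ : ∃ x ∈ A, #{a ∈ A | R a x} ≤ d := by
      by_contra! h
      have h1 : ∑ a ∈ A, #{b ∈ A | R a b} ≤ A.card * d := by
        simpa using Finset.sum_le_sum hd
      have h2 : A.card * (d + 1) ≤ ∑ b ∈ A, #{a ∈ A | R a b} := by
        simpa using Finset.sum_le_sum (f := fun _ => d + 1) h
      have h3 := Finset.sum_card_bipartiteAbove_eq_sum_card_bipartiteBelow (s := A) (t := A) R
      simp only [Finset.bipartiteAbove, Finset.bipartiteBelow] at h3
      have := hA.card_pos
      nlinarith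
    let N := insert x ({b ∈ A | R x b} ∪ {a ∈ A | R a x})
    have hN : N.card ≤ 2 * d + 1 := by
      have h1 := Finset.card_insert_le x ({b ∈ A | R x b} ∪ {a ∈ A | R a x})
      have h2 := Finset.card_union_le {b ∈ A | R x b} {a ∈ A | R a x}
      have h3 := hd x hx
      simp only [N]
      omega
    have hNA : N ⊆ A := Finset.insert_subset hx
      (Finset.union_subset (Finset.filter_subset _ _) (Finset.filter_subset _ _))
    have hss : A \ N ⊂ A := Finset.sdiff_ssubset hNA ⟨x, Finset.mem_insert_self _ _⟩
    obtain ⟨I, hI, hR, hc⟩ := ih (A \ N) hss fun a ha =>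
      (Finset.card_le_card (Finset.filter_subset_filter _ Finset.sdiff_subset)).trans
        (hd a (Finset.mem_sdiff.1 ha).1)
    have hIN : ∀ a ∈ I, a ∈ A ∧ a ≠ x ∧ ¬ R x a ∧ ¬ R a x := by
      intro a ha
      have := hI ha
      simp only [N, Finset.mem_sdiff, Finset.mem_insert, Finset.mem_union,
        Finset.mem_filter] at this
      tauto
    refine ⟨insert x I, ?_, ?_, ?_⟩
    · exact Finset.insert_subset hx (hI.trans Finset.sdiff_subset)
    · intro a ha b hb hab
      rcases Finset.mem_insert.1 ha with rfl | ha' <;>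
        rcases Finset.mem_insert.1 hb with rfl | hb'
      · exact absurd rfl hab
      · exact (hIN b hb').2.2.1
      · exact (hIN a ha').2.2.2
      · exact hR a ha' b hb' hab
    · rw [Finset.card_insert_of_notMem fun h => (hIN x h).2.1 rfl, mul_add, mul_one]
      have := Finset.card_le_card_sdiff_add_card (s := A) (t := N)
      omega

section LightCuts

variable {V : Type*} [Fintype V] [DecidableEq V] {w : V → V → ℝ}

/-- A cut weight with ties broken by the number of separated pairs. -/
noncomputable def cutRank (w : V → V → ℝ) (X : Finset V) : ℝ ×ₗ ℝ :=
  toLex (cutW w X, cutW (fun _ _ => 1) X)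

theorem cutRank_compl (hs : ∀ u v, w u v = w v u) (X : Finset V) :
    cutRank w Xᶜ = cutRank w X := by
  rw [cutRank, cutRank, cutW_compl hs, cutW_compl fun _ _ => rfl]

theorem cutRank_sdiff_lt_or (hs : ∀ u v, w u v = w v u) (hn : ∀ u v, 0 ≤ w u v)
    {X Y : Finset V} (h : Crossing X Y) :
    cutRank w (X \ Y) < cutRank w X ∨ cutRank w (Y \ X) < cutRank w Y := by
  have h1 := cutW_add_cutW_eq hs X Y
  have h2 := cutW_add_cutW_eq (w := fun _ _ => (1 : ℝ)) (fun _ _ => rfl) X Y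
  have h3 := crossWeight_nonneg hn (X ∩ Y) (X ∪ Y)ᶜ
  have h4 : 0 < crossWeight (fun _ _ => (1 : ℝ)) (X ∩ Y) (X ∪ Y)ᶜ := by
    have hp := h.1.card_pos
    have hr := h.2.2.2.card_pos
    simp only [crossWeight, Finset.sum_const, nsmul_eq_mul, mul_one]
    positivity
  simp only [cutRank, Prod.Lex.toLex_lt_toLex]
  by_contra! hcon
  obtain ⟨⟨a1, a2⟩, b1, b2⟩ := hcon
  have ha : cutW w X = cutW w (X \ Y) := by linarith
  have hb : cutW w Y = cutW w (Y \ X) := by linarith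
  have := a2 ha.symm
  have := b2 hb.symm
  linarith

/-- A cut is reducible at threshold `c` if a piece of one side, attached to the other side with
weight less than `c`, can be moved across to give a cut of smaller rank. -/
def Reducible (w : V → V → ℝ) (c : ℝ) (X : Finset V) : Prop :=
  ∃ X' p : Finset V, (X' = X ∨ X' = Xᶜ) ∧ p ⊆ X' ∧ p.Nonempty ∧ cutRank w p < cutRank w X' ∧
    crossWeight w (X' \ p) X'ᶜ < c

theorem Reducible.of_compl {c : ℝ} {X : Finset V} (h : Reducible w c Xᶜ) : Reducible w c X := by
  obtain ⟨X', p, hX', h⟩ := h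
  refine ⟨X', p, ?_, h⟩
  rw [compl_compl] at hX'
  exact hX'.symm

theorem reducible_of_le_crossWeight (hn : ∀ u v, 0 ≤ w u v) {c : ℝ} {X Y : Finset V}
    (hXY : Crossing X Y) (hX : cutW w X < 2 * c)
    (h : c ≤ crossWeight w (X \ Y) (X ∪ Y)ᶜ) (hlt : cutRank w (X \ Y) < cutRank w X) :
    Reducible w c X := by
  refine ⟨X, X \ Y, Or.inl rfl, Finset.sdiff_subset, hXY.2.1, hlt, ?_⟩
  have h1 : cutW w X = crossWeight w (X \ Y) Xᶜ + crossWeight w (X \ (X \ Y)) Xᶜ := by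
    rw [cutW_eq_crossWeight, ← crossWeight_union_left Finset.disjoint_sdiff,
      Finset.union_sdiff_of_subset Finset.sdiff_subset]
  have h2 : crossWeight w (X \ Y) (X ∪ Y)ᶜ ≤ crossWeight w (X \ Y) Xᶜ :=
    crossWeight_mono hn subset_rfl
      (Finset.compl_subset_compl.2 Finset.subset_union_left)
  linarith

theorem reducible_or_reducible (hs : ∀ u v, w u v = w v u) (hn : ∀ u v, 0 ≤ w u v) {c : ℝ}
    {X Y : Finset V} (hXY : Crossing X Y) (hX : cutW w X < 2 * c) (hY : cutW w Y < 2 * c)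
    (hX' : c ≤ crossWeight w (X \ Y) (X ∪ Y)ᶜ) (hY' : c ≤ crossWeight w (Y \ X) (X ∪ Y)ᶜ) :
    Reducible w c X ∨ Reducible w c Y := by
  rcases cutRank_sdiff_lt_or hs hn hXY with h | h
  · exact Or.inl (reducible_of_le_crossWeight hn hXY hX hX' h)
  · rw [Finset.union_comm] at hY'
    exact Or.inr (reducible_of_le_crossWeight hn hXY.symm hY hY' h)

/-- A colouring no class of which can be split at cost less than `c`. -/
def Unsplittable (w : V → V → ℝ) (c : ℝ) (f : V → ℕ) : Prop :=
  ∀ (Z : Finset V) (a b : V), f a = f b → a ∈ Z → b ∉ Z →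
    c ≤ crossWeight w {v ∈ Z | f v = f a} {v ∈ Zᶜ | f v = f a}

theorem Unsplittable.le_crossWeight_or (hn : ∀ u v, 0 ≤ w u v) {c : ℝ} {f : V → ℕ}
    (hf : Unsplittable w c f) {X Y : Finset V} (hX : Respects f X) (hY : ¬ Respects f Y) :
    c ≤ crossWeight w (X ∩ Y) (X \ Y) ∨ c ≤ crossWeight w (Xᶜ ∩ Y) (Xᶜ \ Y) := by
  simp only [Respects, not_forall] at hY
  obtain ⟨a, b, hab, ha, hb⟩ := hY
  have key : ∀ X' : Finset V, Respects f X' → a ∈ X' →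
      c ≤ crossWeight w (X' ∩ Y) (X' \ Y) := by
    intro X' hX' ha'
    refine (hf Y a b hab ha hb).trans (crossWeight_mono hn ?_ ?_) <;> intro v hv <;>
      simp only [Finset.mem_filter, Finset.mem_compl] at hv <;>
      have := hX' a v hv.2.symm ha' <;> simp [this, hv.1]
  by_cases haX : a ∈ X
  · exact Or.inl (key X hX haX)
  · exact Or.inr (key Xᶜ hX.compl (Finset.mem_compl.2 haX))

theorem Unsplittable.respects_of_crossWeight_lt (hn : ∀ u v, 0 ≤ w u v) {c : ℝ} {f : V → ℕ}
    (hf : Unsplittable w c f) {X p : Finset V} (hp : Respects f p) (hpX : p ⊆ X)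
    (h : crossWeight w (X \ p) Xᶜ < c) : Respects f X := by
  by_contra hX
  simp only [Respects, not_forall] at hX
  obtain ⟨a, b, hab, ha, hb⟩ := hX
  refine (hf X a b hab ha hb).not_gt (lt_of_le_of_lt (crossWeight_mono hn ?_ ?_) h)
  · intro v hv
    obtain ⟨hvX, hva⟩ := Finset.mem_filter.1 hv
    exact Finset.mem_sdiff.2 ⟨hvX, fun hvp => hb (hpX (hp v b (hva.trans hab) hvp))⟩
  · exact Finset.filter_subset _ _

/-- Crossing irreducible light cuts: one of them is a union of classes of the unsplittable
colouring attached to the other. -/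
theorem respects_or_respects_of_crossing (hs : ∀ u v, w u v = w v u) (hn : ∀ u v, 0 ≤ w u v)
    {c : ℝ} {X Y : Finset V} {f g : V → ℕ} (hf : Unsplittable w c f) (hg : Unsplittable w c g)
    (hfX : Respects f X) (hgY : Respects g Y) (hX : cutW w X < 2 * c) (hY : cutW w Y < 2 * c)
    (hXr : ¬ Reducible w c X) (hYr : ¬ Reducible w c Y) (hXY : Crossing X Y) :
    Respects f Y ∨ Respects g X := by
  by_contra! hcon
  have hX' : cutW w Xᶜ < 2 * c := by rwa [cutW_compl hs]
  have hY' : cutW w Yᶜ < 2 * c := by rwa [cutW_compl hs]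
  have hXr' : ¬ Reducible w c Xᶜ := fun h => hXr h.of_compl
  have hYr' : ¬ Reducible w c Yᶜ := fun h => hYr h.of_compl
  have q1 : (X ∪ Y)ᶜ = Xᶜ \ Y := by ext; simp
  have q2 : (Xᶜ ∪ Y)ᶜ = X \ Y := by ext; simp
  have q3 : (X ∪ Yᶜ)ᶜ = Y \ X := by ext; simp; tauto
  have q4 : (Xᶜ ∪ Yᶜ)ᶜ = X ∩ Y := by ext; simp
  have q5 : X \ Yᶜ = X ∩ Y := by ext; simp
  have q6 : Y \ Xᶜ = X ∩ Y := by ext; simp; tauto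
  have q7 : Xᶜ ∩ Y = Y \ X := by ext; simp; tauto
  have q8 : Yᶜ ∩ X = X \ Y := by ext; simp; tauto
  have q9 : Yᶜ \ X = Xᶜ \ Y := by ext; simp; tauto
  have q10 : Xᶜ \ Yᶜ = Y \ X := by ext; simp; tauto
  have q11 : Yᶜ \ Xᶜ = X \ Y := by ext; simp; tauto
  have hXf := hf.le_crossWeight_or hn hfX hcon.1
  have hYg := hg.le_crossWeight_or hn hgY hcon.2
  rw [q7] at hXf
  rw [q8, q9, Finset.inter_comm Y X] at hYg
  have r1 := reducible_or_reducible hs hn hXY hX hY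
  have r2 := reducible_or_reducible hs hn hXY.compl_left hX' hY
  have r3 := reducible_or_reducible hs hn hXY.compl_right hX hY'
  have r4 := reducible_or_reducible hs hn hXY.compl_left.compl_right hX' hY'
  rw [q1] at r1
  rw [q2, q6] at r2
  rw [q3, q5, q9] at r3
  rw [q4, q10, q11] at r4
  have s1 := crossWeight_comm hs (X ∩ Y) (X \ Y)
  have s2 := crossWeight_comm hs (X ∩ Y) (Y \ X)
  have s3 := crossWeight_comm hs (Xᶜ \ Y) (X \ Y)
  have s4 := crossWeight_comm hs (Xᶜ \ Y) (Y \ X)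
  rw [s3] at r2
  rw [s4] at r3
  rw [← s1, ← s2] at r4
  tauto

open Classical in
/-- If every `k`-cut has weight at least `k * c`, there are linearly many cuts of weight less than
`2 * c`. -/
theorem card_light_cuts_le (hs : ∀ u v, w u v = w v u) (hn : ∀ u v, 0 ≤ w u v)
    {k : ℕ} {c : ℝ} (hk : 3 ≤ k)
    (hmin : ∀ P : Finpartition (univ : Finset V), P.parts.card = k → k * c ≤ kCutWeight w P) :
    #{X : Finset V | X.Nonempty ∧ Xᶜ.Nonempty ∧ cutW w X < 2 * c} ≤
      (2 * 2 ^ k + 1) * (4 * Fintype.card V) * 2 ^ k := by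
  let light : Finset V → Prop := fun X => X.Nonempty ∧ Xᶜ.Nonempty ∧ cutW w X < 2 * c
  have light_compl : ∀ X, light X → light Xᶜ := by
    rintro X ⟨h1, h2, h3⟩
    exact ⟨h2, by rwa [compl_compl], by rwa [cutW_compl hs]⟩
  have hQ : ∀ X, ∃ f : V → ℕ, light X → (∀ v, f v < k) ∧ Respects f X ∧ Unsplittable w c f := by
    intro X
    by_cases h : light X
    · obtain ⟨f, hf⟩ := exists_unsplittable_colouring hs hn hk hmin h.1 h.2.1 h.2.2
      exact ⟨f, fun _ => hf⟩
    · exact ⟨0, fun h' => absurd h' h⟩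
  choose Q hQ using hQ
  have hreduce : ∀ X, light X → ∃ p, (light p ∧ ¬ Reducible w c p) ∧ Respects (Q p) X := by
    have hwf : WellFounded (InvImage (· < ·) (cutRank w)) :=
      haveI : IsTrans (Finset V) (InvImage (· < ·) (cutRank w)) := ⟨fun _ _ _ => lt_trans⟩
      haveI : Std.Irrefl (InvImage (· < ·) (cutRank w)) := ⟨fun _ => lt_irrefl _⟩
      Finite.wellFounded_of_trans_of_irrefl _
    intro X
    induction X using hwf.induction with
    | _ X ih =>
      intro hX
      by_cases hr : Reducible w c X
      · obtain ⟨X', p, hX', hpX, hp, hlt, hc⟩ := hr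
        have hXl : light X' := by
          rcases hX' with rfl | rfl
          exacts [hX, light_compl _ hX]
        have hrank : cutRank w X' = cutRank w X := by
          rcases hX' with rfl | rfl
          exacts [rfl, cutRank_compl hs X]
        have hle : cutW w p ≤ cutW w X' := by
          simp only [cutRank, Prod.Lex.toLex_lt_toLex] at hlt
          rcases hlt with h | h
          exacts [h.le, h.1.le]
        have hpl : light p :=
          ⟨hp, hXl.2.1.mono (Finset.compl_subset_compl.2 hpX), hle.trans_lt hXl.2.2⟩
        obtain ⟨p', hp', hresp⟩ := ih p (show cutRank w p < cutRank w X from hrank ▸ hlt) hpl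
        have hres := (hQ p' hp'.1).2.2.respects_of_crossWeight_lt hn hresp hpX hc
        refine ⟨p', hp', ?_⟩
        rcases hX' with rfl | rfl
        · exact hres
        · simpa using hres.compl
      · exact ⟨X, ⟨hX, hr⟩, (hQ X hX).2.1⟩
  let F : Finset (Finset V) := {p | light p ∧ ¬ Reducible w c p}
  have hF : F.card ≤ (2 * 2 ^ k + 1) * (4 * Fintype.card V) := by
    refine card_le_of_outdegree_le (fun X Y => Respects (Q X) Y) _ _ F ?_ ?_
    · intro X hX
      exact (Finset.card_le_card (Finset.filter_subset_filter _ (Finset.subset_univ _))).trans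
        (card_respects_le (hQ X (Finset.mem_filter.1 hX).2.1).1)
    · intro I hI hR
      have hI' : ∀ X ∈ I, light X ∧ ¬ Reducible w c X :=
        fun X hX => (Finset.mem_filter.1 (hI hX)).2
      refine card_le_of_pairwise_not_crossing I (fun X hX => ⟨(hI' X hX).1.1, (hI' X hX).1.2.1⟩) ?_
      intro X hX Y hY hXY
      obtain ⟨hXl, hXr⟩ := hI' X hX
      obtain ⟨hYl, hYr⟩ := hI' Y hY
      have hne : X ≠ Y := by
        rintro rfl
        simpa using hXY.2.1
      rcases respects_or_respects_of_crossing hs hn (hQ X hXl).2.2 (hQ Y hYl).2.2 (hQ X hXl).2.1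
        (hQ Y hYl).2.1 hXl.2.2 hYl.2.2 hXr hYr hXY with h | h
      · exact hR X hX Y hY hne h
      · exact hR Y hY X hX hne.symm h
  have hcover : ({X | light X} : Finset (Finset V)) ⊆
      F.biUnion fun p => ({X | Respects (Q p) X} : Finset (Finset V)) := by
    intro X hX
    obtain ⟨p, hp, hpX⟩ := hreduce X (Finset.mem_filter.1 hX).2
    exact Finset.mem_biUnion.2 ⟨p, Finset.mem_filter.2 ⟨Finset.mem_univ p, hp⟩,
      Finset.mem_filter.2 ⟨Finset.mem_univ X, hpX⟩⟩
  refine (Finset.card_le_card hcover).trans ?_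
  refine (Finset.card_biUnion_le_card_mul F _ (2 ^ k) fun p hp => ?_).trans
    (Nat.mul_le_mul_right _ hF)
  exact card_respects_le (hQ p (Finset.mem_filter.1 hp).2.1).1

end LightCuts

/-- There is an absolute constant `C > 0` such that for every integer `k ≥ 3` and every
weighted multigraph on a vertex set `V` with `|V| = n ≥ k`, the number of medium cuts
(counted as unordered pairs `{S, Sᶜ}` with `λ_k/(k-1) ≤ ∂S < 2λ_k/k`) is at most
`k^(C·k) · n`. -/
theorem number_of_medium_cuts :
    ∃ C : ℝ, 0 < C ∧
      ∀ (k : ℕ) (V : Type) [Fintype V] [DecidableEq V] (w : V → V → ℝ) (lam : ℝ),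
        3 ≤ k →
        k ≤ Fintype.card V →
        (∀ u v, w u v = w v u) →
        (∀ u v, 0 ≤ w u v) →
        (∀ v, w v v = 0) →
        (∃ P : Finpartition (univ : Finset V), P.parts.card = k ∧ kCutWeight w P = lam) →
        (∀ P : Finpartition (univ : Finset V), P.parts.card = k → lam ≤ kCutWeight w P) →
        ({p : Finset (Finset V) | ∃ S : Finset V, p = {S, Sᶜ} ∧
            S.Nonempty ∧ Sᶜ.Nonempty ∧
            lam / ((k : ℝ) - 1) ≤ cutW w S ∧ cutW w S < 2 * lam / k}.ncard : ℝ) ≤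
          (k : ℝ) ^ (C * k) * (Fintype.card V : ℝ) := by
  classical
  refine ⟨4, by norm_num, ?_⟩
  intro k V _ _ w lam hk _ hs hn _ _ hmin
  have hk0 : (0 : ℝ) < k := by exact_mod_cast (by omega : 0 < k)
  have hlight := card_light_cuts_le (c := lam / k) hs hn hk fun P hP => by
    rw [mul_div_cancel₀ lam hk0.ne']
    exact hmin P hP
  set L : Finset (Finset V) := {X | X.Nonempty ∧ Xᶜ.Nonempty ∧ cutW w X < 2 * (lam / k)}
  have hsub : {p : Finset (Finset V) | ∃ S : Finset V, p = {S, Sᶜ} ∧ S.Nonempty ∧ Sᶜ.Nonempty ∧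
      lam / ((k : ℝ) - 1) ≤ cutW w S ∧ cutW w S < 2 * lam / k} ⊆
      ((L.image fun S => {S, Sᶜ} : Finset (Finset (Finset V))) : Set (Finset (Finset V))) := by
    rintro p ⟨S, rfl, h1, h2, -, h3⟩
    refine Finset.mem_coe.2 (Finset.mem_image.2 ⟨S, ?_, rfl⟩)
    simp only [L, Finset.mem_filter, Finset.mem_univ, true_and]
    exact ⟨h1, h2, by rwa [← mul_div_assoc]⟩
  have hcard := (Set.ncard_le_ncard hsub (Finset.finite_toSet _)).trans
    ((Set.ncard_coe_finset _).trans_le (Finset.card_image_le.trans hlight))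
  have hpow : (2 * 2 ^ k + 1) * (4 * Fintype.card V) * 2 ^ k ≤
      k ^ (4 * k) * Fintype.card V := by
    have h8 : 2 ^ 3 ≤ 2 ^ k := Nat.pow_le_pow_right (by norm_num) hk
    have h1 : (2 * 2 ^ k + 1) * 4 * 2 ^ k ≤ (2 ^ k) ^ 4 := by
      generalize 2 ^ k = x at h8
      have h2 : (2 * x + 1) * 4 ≤ x ^ 3 := by nlinarith [Nat.mul_le_mul h8 h8, Nat.zero_le x]
      calc (2 * x + 1) * 4 * x ≤ x ^ 3 * x := Nat.mul_le_mul_right x h2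
        _ = x ^ 4 := by ring
    calc (2 * 2 ^ k + 1) * (4 * Fintype.card V) * 2 ^ k
        = (2 * 2 ^ k + 1) * 4 * 2 ^ k * Fintype.card V := by ring
      _ ≤ (2 ^ k) ^ 4 * Fintype.card V := Nat.mul_le_mul_right _ h1
      _ = 2 ^ (4 * k) * Fintype.card V := by rw [← pow_mul, mul_comm k 4]
      _ ≤ k ^ (4 * k) * Fintype.card V :=
        Nat.mul_le_mul_right _ (Nat.pow_le_pow_left (by omega) _)
  have hrpow : (k : ℝ) ^ ((4 : ℝ) * k) = (k : ℝ) ^ (4 * k) := by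
    rw [← Real.rpow_natCast]
    push_cast
    rfl
  rw [hrpow]
  exact_mod_cast hcard.trans hpow
end

section
/- For every integer k ≥ 2 and every weighted multigraph on a vertex set V with |V| = n ≥ k, the total edge weight m satisfies m ≥ n·λ_k / (2(k−1)). -/
open Finset

/-- Separating each vertex of a proper subset `S` as a singleton gives a partition with
`#S + 1` parts whose cut weight is at most the sum of the weighted degrees over `S`. -/
theorem exists_finpartition_kCutWeight_le {V : Type*} [Fintype V] [DecidableEq V]
    {w : V → V → ℝ} (hsymm : ∀ u v, w u v = w v u) (hnonneg : ∀ u v, 0 ≤ w u v)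
    {S : Finset V} (hS : #S < Fintype.card V) :
    ∃ P : Finpartition (univ : Finset V), #P.parts = #S + 1 ∧
      kCutWeight w P ≤ ∑ u ∈ S, ∑ v, w u v := by
  have hne : Sᶜ ≠ ⊥ := by
    rw [bot_eq_empty, ← nonempty_iff_ne_empty, ← card_pos, card_compl]
    omega
  refine ⟨(⊥ : Finpartition S).extend hne disjoint_compl_right sup_compl_eq_top, ?_, ?_⟩
  · rw [Finpartition.card_extend, Finpartition.card_bot]
  · have hterm : ∀ u v,
        (if ∃ p ∈ ((⊥ : Finpartition S).extend hne disjoint_compl_right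
          (sup_compl_eq_top : S ⊔ Sᶜ = (univ : Finset V))).parts, u ∈ p ∧ v ∈ p
          then (0 : ℝ) else w u v) ≤
        (if u ∈ S then w u v else 0) + (if v ∈ S then w v u else 0) := by
      intro u v
      have huv := hnonneg u v
      have hvu := hnonneg v u
      split_ifs with h hu hv hv hu hv hv <;> try linarith [hsymm u v]
      exact absurd ⟨Sᶜ, by simp, by simpa using hu, by simpa using hv⟩ h
    have hsum : ∑ u, ∑ v, (if u ∈ S then w u v else 0) = ∑ u ∈ S, ∑ v, w u v := by
      simp only [sum_ite_irrel, sum_const_zero, sum_ite_mem, univ_inter]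
    have hsum' : ∑ u, ∑ v, (if v ∈ S then w v u else 0) = ∑ u ∈ S, ∑ v, w u v := by
      rw [sum_comm, hsum]
    have hle := sum_le_sum fun u (_ : u ∈ univ) ↦ sum_le_sum fun v (_ : v ∈ univ) ↦ hterm u v
    simp only [sum_add_distrib] at hle
    rw [hsum, hsum'] at hle
    unfold kCutWeight
    linarith

/-- A lower bound for the sum of `f` over every `r`-element subset of `V`
gives, by averaging over cyclic intervals, a lower bound for the total sum. -/
theorem card_mul_le_mul_sum_of_forall_card_eq {V : Type*} [Fintype V] [DecidableEq V]
    {f : V → ℝ} {c : ℝ} {r : ℕ} (hr : r ≤ Fintype.card V)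
    (h : ∀ S : Finset V, #S = r → c ≤ ∑ u ∈ S, f u) :
    Fintype.card V * c ≤ r * ∑ u, f u := by
  rcases Nat.eq_zero_or_pos (Fintype.card V) with h0 | hpos
  · have : IsEmpty V := Fintype.card_eq_zero_iff.mp h0
    simp
  have : NeZero (Fintype.card V) := ⟨hpos.ne'⟩
  let e : ZMod (Fintype.card V) ≃ V := Fintype.equivOfCardEq (ZMod.card _)
  have hinj (i : ZMod (Fintype.card V)) :
      Set.InjOn (fun j : ℕ ↦ e (i + j)) (range r) := by
    intro a ha b hb hab
    simp only [coe_range, Set.mem_Iio] at ha hb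
    have hcast := add_left_cancel (e.injective hab)
    rw [ZMod.natCast_eq_natCast_iff] at hcast
    exact hcast.eq_of_lt_of_lt (ha.trans_le hr) (hb.trans_le hr)
  have hshift (i : ZMod (Fintype.card V)) : c ≤ ∑ j ∈ range r, f (e (i + j)) := by
    have := h ((range r).image fun j : ℕ ↦ e (i + j))
      (by rw [card_image_of_injOn (hinj i), card_range])
    rwa [sum_image (hinj i)] at this
  calc (Fintype.card V : ℝ) * c = ∑ _i : ZMod (Fintype.card V), c := by simp [ZMod.card]
    _ ≤ ∑ i : ZMod (Fintype.card V), ∑ j ∈ range r, f (e (i + j)) :=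
      sum_le_sum fun i _ ↦ hshift i
    _ = ∑ j ∈ range r, ∑ i : ZMod (Fintype.card V), f (e (i + j)) := sum_comm
    _ = ∑ _j ∈ range r, ∑ u, f u := sum_congr rfl fun j _ ↦
      Equiv.sum_comp ((Equiv.addRight (j : ZMod (Fintype.card V))).trans e) f
    _ = r * ∑ u, f u := by simp

/-- For every integer `k ≥ 2` and every weighted multigraph on a vertex set `V` with
`|V| = n ≥ k`, the total edge weight `m = (1/2)·∑_{u,v} w(u,v)` satisfies
`m ≥ n·λ_k / (2(k−1))`. -/
theorem total_weight_lower_bound (k : ℕ) (hk : 2 ≤ k)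
    (V : Type) [Fintype V] [DecidableEq V] (w : V → V → ℝ) (lam : ℝ)
    (hn : k ≤ Fintype.card V)
    (hsymm : ∀ u v, w u v = w v u)
    (hnonneg : ∀ u v, 0 ≤ w u v)
    (hdiag : ∀ v, w v v = 0)
    (hex : ∃ P : Finpartition (univ : Finset V), P.parts.card = k ∧ kCutWeight w P = lam)
    (hmin : ∀ P : Finpartition (univ : Finset V), P.parts.card = k → lam ≤ kCutWeight w P) :
    (Fintype.card V : ℝ) * lam / (2 * ((k : ℝ) - 1)) ≤ (1 / 2) * ∑ u, ∑ v, w u v := by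
  have havg := card_mul_le_mul_sum_of_forall_card_eq (f := fun u ↦ ∑ v, w u v) (c := lam)
    (r := k - 1) (by omega) fun S hS ↦ by
      obtain ⟨P, hP, hle⟩ := exists_finpartition_kCutWeight_le hsymm hnonneg
        (S := S) (by omega)
      exact (hmin P (by omega)).trans hle
  rw [Nat.cast_sub (by omega), Nat.cast_one] at havg
  have hk' : (2 : ℝ) ≤ k := by exact_mod_cast hk
  rw [div_le_iff₀ (by linarith)]
  linarith
end

section
/- For every integer k ≥ 3 and every weighted multigraph on a vertex set V with |V| = n ≥ k, the number of small cuts is strictly less than 2^{k−2}. -/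
open Finset

/-- The members of `G` containing `v`; two vertices lie in the same atom of `G` iff their traces
agree. -/
def cutTrace {V : Type*} [DecidableEq V] (G : Finset (Finset V)) (v : V) : Finset (Finset V) :=
  {S ∈ G | v ∈ S}

lemma cutTrace_eq_iff {V : Type*} [DecidableEq V] {G : Finset (Finset V)} {u v : V} :
    cutTrace G u = cutTrace G v ↔ ∀ S ∈ G, (u ∈ S ↔ v ∈ S) := by
  simp only [cutTrace, Finset.ext_iff, mem_filter, and_congr_right_iff]

lemma cutTrace_eq_mono {V : Type*} [DecidableEq V] {G H : Finset (Finset V)} (h : G ⊆ H) {u v : V}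
    (huv : cutTrace H u = cutTrace H v) : cutTrace G u = cutTrace G v :=
  cutTrace_eq_iff.2 fun S hS => cutTrace_eq_iff.1 huv S (h hS)

/-- If `j ≥ 1` vertices are pairwise separated by a family of cuts, then some `j` vertices are
pairwise separated by fewer than `j` members of the family. -/
lemma exists_small_separating_subfamily {V : Type*} [DecidableEq V]
    (F : Finset (Finset V)) (Y : Finset V) (hY : Set.InjOn (cutTrace F) Y) (j : ℕ)
    (hj : j + 1 ≤ #Y) :
    ∃ G ⊆ F, #G ≤ j ∧ ∃ X : Finset V, #X = j + 1 ∧ Set.InjOn (cutTrace G) X := by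
  induction j with
  | zero =>
    obtain ⟨y, -⟩ := card_pos.1 hj
    exact ⟨∅, by simp, by simp, {y}, by simp, by simp⟩
  | succ j ih =>
    obtain ⟨G, hGF, hG, X, hX, hinj⟩ := ih (by omega)
    by_cases hnew : ∃ y, ∀ x ∈ X, cutTrace G y ≠ cutTrace G x
    · obtain ⟨y, hy⟩ := hnew
      have hyX : y ∉ X := fun h => hy y h rfl
      refine ⟨G, hGF, by omega, insert y X, by rw [card_insert_of_notMem hyX, hX], ?_⟩
      rw [coe_insert, Set.injOn_insert (by simpa using hyX)]
      refine ⟨hinj, ?_⟩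
      rintro ⟨x, hx, h⟩
      exact hy x hx h.symm
    · push Not at hnew
      choose r hrX hr using hnew
      obtain ⟨a, ha, b, hb, hab, hrab⟩ :=
        exists_ne_map_eq_of_card_lt_of_maps_to (s := Y) (t := X) (f := r) (by omega)
          (fun y _ => hrX y)
      obtain ⟨y, hy⟩ : ∃ y, cutTrace F y ≠ cutTrace F (r y) := by
        by_contra! h
        exact hab (hY ha hb (by rw [h a, h b, hrab]))
      rw [Ne, cutTrace_eq_iff] at hy
      push Not at hy
      obtain ⟨S, hS, hSy⟩ := hy
      have hsep : cutTrace (insert S G) y ≠ cutTrace (insert S G) (r y) := fun h => by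
        have := cutTrace_eq_iff.1 h S (mem_insert_self _ _)
        tauto
      have hout : ∀ x ∈ X, cutTrace (insert S G) x ≠ cutTrace (insert S G) y := by
        intro x hx h
        have hxr : x = r y :=
          hinj hx (hrX y) ((cutTrace_eq_mono (subset_insert S G) h).trans (hr y))
        subst hxr
        exact hsep h.symm
      have hyX : y ∉ X := fun h => hout y h rfl
      refine ⟨insert S G, insert_subset hS hGF, (card_insert_le _ _).trans (by omega),
        insert y X, by rw [card_insert_of_notMem hyX, hX], ?_⟩
      rw [coe_insert, Set.injOn_insert (by simpa using hyX)]
      refine ⟨fun a ha b hb h => hinj ha hb (cutTrace_eq_mono (subset_insert S G) h), ?_⟩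
      rintro ⟨x, hx, h⟩
      exact hout x hx h

lemma cutW_eq_half_sum {V : Type*} [Fintype V] [DecidableEq V] (w : V → V → ℝ)
    (hsymm : ∀ u v, w u v = w v u) (S : Finset V) :
    cutW w S = (1 / 2) * ∑ u, ∑ v, if (u ∈ S ↔ v ∈ S) then 0 else w u v := by
  have hleft : cutW w S = ∑ u, ∑ v, if u ∈ S ∧ v ∉ S then w u v else 0 := by
    simp only [cutW, ite_and, sum_ite_irrel, sum_const_zero, ← sum_filter]
    refine sum_congr (by ext; simp) fun u _ => sum_congr (by ext; simp) fun v _ => rfl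
  have hright : cutW w S = ∑ u, ∑ v, if v ∈ S ∧ u ∉ S then w u v else 0 := by
    rw [hleft, sum_comm]
    exact sum_congr rfl fun u _ => sum_congr rfl fun v _ => by rw [hsymm]
  have hsum : (∑ u, ∑ v, if (u ∈ S ↔ v ∈ S) then 0 else w u v) = cutW w S + cutW w S := by
    nth_rewrite 1 [hleft]
    rw [hright]
    simp only [← sum_add_distrib]
    refine sum_congr rfl fun u _ => sum_congr rfl fun v _ => ?_
    by_cases hu : u ∈ S <;> by_cases hv : v ∈ S <;> simp [hu, hv]
  rw [hsum]
  ring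

/-- If `k` vertices are pairwise separated by a family of cuts, then some `k`-cut weighs at most
as much as all members of the family together. -/
lemma exists_kCutWeight_le_sum_cutW {V : Type*} [Fintype V] [DecidableEq V] (w : V → V → ℝ)
    (hsymm : ∀ u v, w u v = w v u) (hnonneg : ∀ u v, 0 ≤ w u v)
    (G : Finset (Finset V)) (X : Finset V) (hne : X.Nonempty)
    (hinj : Set.InjOn (cutTrace G) X) :
    ∃ P : Finpartition (univ : Finset V), #P.parts = #X ∧ kCutWeight w P ≤ ∑ S ∈ G, cutW w S := by
  classical
  obtain ⟨x₀, hx₀⟩ := hne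
  obtain ⟨g, hgX, hg, hgG⟩ : ∃ g : V → V, (∀ v, g v ∈ X) ∧ (∀ x ∈ X, g x = x) ∧
      ∀ u v, cutTrace G u = cutTrace G v → g u = g v := by
    let h : Finset (Finset V) → V := fun T =>
      if hT : ∃ x ∈ X, cutTrace G x = T then hT.choose else x₀
    refine ⟨fun v => h (cutTrace G v), fun v => ?_, fun x hx => ?_, fun u v huv => by
      simp only [huv]⟩
    · by_cases hT : ∃ x ∈ X, cutTrace G x = cutTrace G v
      · simp only [h, dif_pos hT]
        exact hT.choose_spec.1
      · simp only [h, dif_neg hT]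
        exact hx₀
    · have hT : ∃ y ∈ X, cutTrace G y = cutTrace G x := ⟨x, hx, rfl⟩
      simp only [h, dif_pos hT]
      exact hinj hT.choose_spec.1 hx hT.choose_spec.2
  let P : Finpartition (univ : Finset V) := Finpartition.ofSetoid (Setoid.ker g)
  have hmem : ∀ u v, (∃ p ∈ P.parts, u ∈ p ∧ v ∈ p) ↔ g u = g v := by
    intro u v
    constructor
    · rintro ⟨p, hp, hu, hv⟩
      simp only [P, Finpartition.ofSetoid, Finpartition.ofSetSetoid, mem_image, Setoid.ker_def]
        at hp
      obtain ⟨a, -, rfl⟩ := hp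
      simp only [mem_filter] at hu hv
      exact hu.2.symm.trans hv.2
    · intro h
      refine ⟨P.part u, P.part_mem.2 (mem_univ u), P.mem_part (mem_univ u), ?_⟩
      exact Finpartition.mem_part_ofSetoid_iff_rel.2 h
  refine ⟨P, ?_, ?_⟩
  · refine (card_nbij' (fun x => P.part x) (fun p => if hp : p.Nonempty then g hp.choose else x₀)
      ?_ ?_ ?_ ?_).symm
    · intro x _
      exact P.part_mem.2 (mem_univ x)
    · intro p _
      dsimp only
      split_ifs
      exacts [hgX _, hx₀]
    · intro x hx
      have hp : (P.part x).Nonempty := ⟨x, P.mem_part (mem_univ x)⟩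
      simp only [dif_pos hp]
      rw [(hmem hp.choose x).1 ⟨_, P.part_mem.2 (mem_univ x), hp.choose_spec,
        P.mem_part (mem_univ x)⟩, hg x hx]
    · intro p hp
      have hpn : p.Nonempty := P.nonempty_of_mem_parts hp
      simp only [dif_pos hpn]
      obtain ⟨q, hq, h1, h2⟩ := (hmem hpn.choose (g hpn.choose)).2 (hg _ (hgX _)).symm
      rw [P.part_eq_of_mem hq h2]
      exact P.eq_of_mem_parts hq hp h1 hpn.choose_spec
  · simp only [cutW_eq_half_sum w hsymm, kCutWeight, hmem]
    rw [← mul_sum]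
    refine mul_le_mul_of_nonneg_left ?_ (by norm_num)
    have hswap : ∑ S ∈ G, ∑ u, ∑ v, (if (u ∈ S ↔ v ∈ S) then 0 else w u v) =
        ∑ u, ∑ v, ∑ S ∈ G, if (u ∈ S ↔ v ∈ S) then 0 else w u v :=
      sum_comm.trans (sum_congr rfl fun u _ => sum_comm)
    rw [hswap]
    refine sum_le_sum fun u _ => sum_le_sum fun v _ => ?_
    have hterm : ∀ S ∈ G, 0 ≤ if (u ∈ S ↔ v ∈ S) then 0 else w u v := fun S _ => by
      split_ifs
      exacts [le_rfl, hnonneg u v]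
    split_ifs with h
    · exact sum_nonneg hterm
    · have hsep := mt (hgG u v) h
      rw [cutTrace_eq_iff] at hsep
      push Not at hsep
      obtain ⟨S, hS, hSuv⟩ := hsep
      refine le_trans ?_ (single_le_sum hterm hS)
      rw [if_neg (by tauto)]

/-- A family of proper subsets through a common point whose traces take at most `m + 1` values has
fewer than `2 ^ m` members. -/
lemma card_lt_two_pow_of_card_traces_le {V : Type*} [Fintype V] [DecidableEq V]
    (F : Finset (Finset V)) (v₀ : V) (hv₀ : ∀ S ∈ F, v₀ ∈ S) (huniv : ∀ S ∈ F, S ≠ univ) (m : ℕ)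
    (hm : #(univ.image (cutTrace F)) ≤ m + 1) : #F < 2 ^ m := by
  have hmem : ∀ S ∈ F, ∀ v, cutTrace F v ∈ S.image (cutTrace F) ↔ v ∈ S := by
    intro S hS v
    refine ⟨fun h => ?_, fun h => mem_image_of_mem _ h⟩
    obtain ⟨u, hu, huv⟩ := mem_image.1 h
    exact (cutTrace_eq_iff.1 huv S hS).1 hu
  let A := (univ.image (cutTrace F)).erase (cutTrace F v₀)
  have hA : #A ≤ m := by
    rw [card_erase_of_mem (mem_image_of_mem _ (mem_univ _))]
    omega
  have hcard : #F ≤ #A.ssubsets := by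
    refine card_le_card_of_injOn (fun S => (S.image (cutTrace F)).erase (cutTrace F v₀)) ?_ ?_
    · intro S hS
      rw [mem_coe, mem_ssubsets, ssubset_iff_subset_ne]
      refine ⟨erase_subset_erase _ (image_subset_image (subset_univ _)), fun h => huniv S hS ?_⟩
      refine eq_univ_of_forall fun v => ?_
      by_cases hv : cutTrace F v = cutTrace F v₀
      · exact (cutTrace_eq_iff.1 hv S hS).2 (hv₀ S hS)
      · have : cutTrace F v ∈ A := mem_erase.2 ⟨hv, mem_image_of_mem _ (mem_univ _)⟩
        rw [← h] at this
        exact (hmem S hS v).1 (mem_of_mem_erase this)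
    · intro S hS T hT h
      have himage : S.image (cutTrace F) = T.image (cutTrace F) := by
        rw [← insert_erase ((hmem S hS v₀).2 (hv₀ S hS)),
          ← insert_erase ((hmem T hT v₀).2 (hv₀ T hT))]
        exact congrArg _ h
      ext v
      rw [← hmem S hS, ← hmem T hT, himage]
  have hpow : 2 ^ #A ≤ 2 ^ m := Nat.pow_le_pow_right (by norm_num) hA
  have hpos : 0 < 2 ^ #A := by positivity
  rw [ssubsets, card_erase_of_mem (mem_powerset_self A), card_powerset] at hcard
  omega

/-- For every integer `k ≥ 3` and every weighted multigraph on a vertex set `V` with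
`|V| = n ≥ k`, the number of small cuts (unordered pairs `{S, Sᶜ}` with
`∂S < λ_k/(k−1)`) is strictly less than `2^(k−2)`. -/
theorem number_of_small_cuts (k : ℕ) (hk : 3 ≤ k)
    (V : Type) [Fintype V] [DecidableEq V] (w : V → V → ℝ) (lam : ℝ)
    (hn : k ≤ Fintype.card V)
    (hsymm : ∀ u v, w u v = w v u)
    (hnonneg : ∀ u v, 0 ≤ w u v)
    (hdiag : ∀ v, w v v = 0)
    (hex : ∃ P : Finpartition (univ : Finset V), P.parts.card = k ∧ kCutWeight w P = lam)
    (hmin : ∀ P : Finpartition (univ : Finset V), P.parts.card = k → lam ≤ kCutWeight w P) :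
    {p : Finset (Finset V) | ∃ S : Finset V, p = {S, Sᶜ} ∧
        S.Nonempty ∧ Sᶜ.Nonempty ∧ cutW w S < lam / ((k : ℝ) - 1)}.ncard < 2 ^ (k - 2) := by
  classical
  obtain ⟨v₀⟩ : Nonempty V := Fintype.card_pos_iff.1 (by omega)
  have hk1 : (0 : ℝ) < (k : ℝ) - 1 := by
    have : (3 : ℝ) ≤ k := by exact_mod_cast hk
    linarith
  have hcompl : ∀ S, cutW w Sᶜ = cutW w S := fun S => by
    simp only [cutW_eq_half_sum w hsymm, mem_compl, not_iff_not]
  let F : Finset (Finset V) :=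
    {S | v₀ ∈ S ∧ S ≠ univ ∧ cutW w S < lam / ((k : ℝ) - 1)}
  have hF : ∀ {S}, S ∈ F ↔ v₀ ∈ S ∧ S ≠ univ ∧ cutW w S < lam / ((k : ℝ) - 1) := by simp [F]
  have hsub : {p : Finset (Finset V) | ∃ S : Finset V, p = {S, Sᶜ} ∧
      S.Nonempty ∧ Sᶜ.Nonempty ∧ cutW w S < lam / ((k : ℝ) - 1)} ⊆
      ((F.image fun S => ({S, Sᶜ} : Finset (Finset V)) : Finset (Finset (Finset V))) :
        Set (Finset (Finset V))) := by
    rintro p ⟨S, rfl, hS, hSc, hlt⟩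
    rw [mem_coe, mem_image]
    by_cases hv : v₀ ∈ S
    · refine ⟨S, hF.2 ⟨hv, ?_, hlt⟩, rfl⟩
      rintro rfl
      simp at hSc
    · refine ⟨Sᶜ, hF.2 ⟨mem_compl.2 hv, ?_, by rwa [hcompl]⟩, by rw [compl_compl, pair_comm]⟩
      intro h
      simp [(compl_eq_univ_iff S).1 h] at hS
  have hncard := (Set.ncard_le_ncard hsub (finite_toSet _)).trans
    ((Set.ncard_coe_finset _).trans_le card_image_le)
  refine hncard.trans_lt (card_lt_two_pow_of_card_traces_le F v₀ (fun S hS => (hF.1 hS).1)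
    (fun S hS => (hF.1 hS).2.1) (k - 2) ?_)
  by_contra! hlarge
  obtain ⟨Y, hYimage, hY⟩ :=
    Set.exists_image_eq_and_injOn (Set.univ : Set V) (cutTrace F)
  have hYcard : #Y.toFinset = #(univ.image (cutTrace F)) := by
    rw [← card_image_of_injOn (s := Y.toFinset) (by simpa using hY)]
    congr 1
    rw [← coe_inj]
    simpa using hYimage
  obtain ⟨G, hGF, hG, X, hX, hinj⟩ :=
    exists_small_separating_subfamily F Y.toFinset (by simpa using hY) (k - 1) (by omega)
  obtain ⟨P, hPX, hP⟩ := exists_kCutWeight_le_sum_cutW w hsymm hnonneg G X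
    (card_pos.1 (by omega)) hinj
  have hlam : lam ≤ ∑ S ∈ G, cutW w S := (hmin P (by omega)).trans hP
  have hGne : G.Nonempty := by
    rw [nonempty_iff_ne_empty]
    rintro rfl
    have := card_le_card_of_injOn (s := X) (t := {∅}) (cutTrace ∅)
      (fun x _ => by simp [cutTrace]) hinj
    simp at this
    omega
  have hsum : ∑ S ∈ G, cutW w S < ∑ _S ∈ G, lam / ((k : ℝ) - 1) :=
    sum_lt_sum_of_nonempty hGne fun S hS => (hF.1 (hGF hS)).2.2
  obtain ⟨S, hS⟩ := hGne
  have hpos : 0 ≤ lam / ((k : ℝ) - 1) :=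
    (sum_nonneg fun u _ => sum_nonneg fun v _ => hnonneg u v).trans (hF.1 (hGF hS)).2.2.le
  have hGk : (#G : ℝ) ≤ (k : ℝ) - 1 := by
    have : #G + 1 ≤ k := by omega
    have : ((#G + 1 : ℕ) : ℝ) ≤ k := by exact_mod_cast this
    push_cast at this
    linarith
  have hbound := mul_le_mul_of_nonneg_right hGk hpos
  rw [mul_div_cancel₀ _ hk1.ne'] at hbound
  rw [sum_const, nsmul_eq_mul] at hsum
  linarith
end
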